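/- arXiv:2509.24079 — 12 statements merged into one kernel-verified Lean document; each statement's English description precedes it below -/
import Mathlib

section
/- For every integer n ≥ 3 and every real list (λ_0, λ_1, …, λ_{n−1}) with λ_0 = 1 and λ_j ≤ 0 for 1 ≤ j ≤ n−1, each entry p_{kl} of P(Λ) = Q Λ Qᵀ (with Q the canonical cycle basis) satisfies p_{kl} ≥ (1/n)·(1 + 2·c_n·∑_{j=1}^{n−1} λ_j), where c_n := max over 1 ≤ j ≤ n−1 and 0 ≤ k,l ≤ n−1 of S_j(k)·S_j(l). -/
open Real Matrix Finset

/-- `S n j k = sin(2πjk/n + π/4)`. -/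
noncomputable def S (n j k : ℕ) : ℝ :=
  Real.sin (2 * Real.pi * (j : ℝ) * (k : ℝ) / (n : ℝ) + Real.pi / 4)

/-- The canonical cycle basis. -/
noncomputable def cycleQ (n : ℕ) : Matrix (Fin n) (Fin n) ℝ :=
  Matrix.of fun k j =>
    if (j : ℕ) = 0 then 1 / Real.sqrt n
    else Real.sqrt (2 / n) * Real.sin (2 * Real.pi * ((j : ℕ) : ℝ) * ((k : ℕ) : ℝ) / (n : ℝ)
      + Real.pi / 4)

/-- `c_n`: the maximum of `S_j(k)·S_j(l)` over `1 ≤ j ≤ n−1`, `0 ≤ k,l ≤ n−1`. -/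
noncomputable def cConst (n : ℕ) : ℝ :=
  sSup {x : ℝ | ∃ j k l : Fin n, (j : ℕ) ≠ 0 ∧ x = S n j k * S n j l}

lemma bddAbove_S_mul_S (n : ℕ) :
    BddAbove {x : ℝ | ∃ j k l : Fin n, (j : ℕ) ≠ 0 ∧ x = S n j k * S n j l} := by
  have hfin : (Set.range fun t : Fin n × Fin n × Fin n =>
      S n t.1 t.2.1 * S n t.1 t.2.2).Finite := Set.finite_range _
  refine hfin.bddAbove.mono ?_
  rintro x ⟨j, k, l, -, rfl⟩
  exact ⟨(j, k, l), rfl⟩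

lemma S_mul_S_le_cConst {n : ℕ} (j k l : Fin n) (hj : (j : ℕ) ≠ 0) :
    S n j k * S n j l ≤ cConst n :=
  le_csSup (bddAbove_S_mul_S n) ⟨j, k, l, hj, rfl⟩

lemma cycleQ_mul_cycleQ_of_eq_zero {n : ℕ} (j k l : Fin n) (hj : (j : ℕ) = 0) :
    cycleQ n k j * cycleQ n l j = 1 / n := by
  simp only [cycleQ, Matrix.of_apply, hj, if_true]
  rw [div_mul_div_comm, Real.mul_self_sqrt n.cast_nonneg, one_mul]

lemma cycleQ_mul_cycleQ_of_ne_zero {n : ℕ} (j k l : Fin n) (hj : (j : ℕ) ≠ 0) :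
    cycleQ n k j * cycleQ n l j = 2 / n * (S n j k * S n j l) := by
  simp only [cycleQ, Matrix.of_apply, hj, if_false]
  rw [mul_mul_mul_comm, Real.mul_self_sqrt (by positivity)]
  rfl

theorem stmt1 (n : ℕ) (hn : 3 ≤ n) (lam : Fin n → ℝ)
    (h0 : ∀ j : Fin n, (j : ℕ) = 0 → lam j = 1)
    (hneg : ∀ j : Fin n, (j : ℕ) ≠ 0 → lam j ≤ 0) (k l : Fin n) :
    (cycleQ n * Matrix.diagonal lam * (cycleQ n)ᵀ) k l
      ≥ (1 / n) * (1 + 2 * cConst n *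
          ∑ j ∈ Finset.univ.filter (fun j : Fin n => (j : ℕ) ≠ 0), lam j) := by
  have hentry : (cycleQ n * Matrix.diagonal lam * (cycleQ n)ᵀ) k l
      = ∑ j, cycleQ n k j * cycleQ n l j * lam j := by
    rw [Matrix.mul_apply]
    refine Finset.sum_congr rfl fun j _ => ?_
    rw [Matrix.mul_diagonal, Matrix.transpose_apply, mul_right_comm]
  have hfilter : Finset.univ.filter (fun j : Fin n => (j : ℕ) = 0) = {⟨0, by omega⟩} := by
    ext j
    simp [Fin.ext_iff]
  have hzero : ∑ j ∈ Finset.univ.filter (fun j : Fin n => (j : ℕ) = 0),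
      cycleQ n k j * cycleQ n l j * lam j = 1 / n := by
    rw [hfilter, Finset.sum_singleton, cycleQ_mul_cycleQ_of_eq_zero _ k l rfl, h0 _ rfl, mul_one]
  have hrest : 2 / n * cConst n * ∑ j ∈ Finset.univ.filter (fun j : Fin n => (j : ℕ) ≠ 0), lam j
      ≤ ∑ j ∈ Finset.univ.filter (fun j : Fin n => (j : ℕ) ≠ 0),
        cycleQ n k j * cycleQ n l j * lam j := by
    rw [Finset.mul_sum]
    refine Finset.sum_le_sum fun j hj => ?_
    have hj' : (j : ℕ) ≠ 0 := (Finset.mem_filter.mp hj).2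
    rw [cycleQ_mul_cycleQ_of_ne_zero j k l hj']
    refine mul_le_mul_of_nonpos_right ?_ (hneg j hj')
    exact mul_le_mul_of_nonneg_left (S_mul_S_le_cConst j k l hj') (by positivity)
  rw [hentry, ← Finset.sum_filter_add_sum_filter_not Finset.univ (fun j : Fin n => (j : ℕ) = 0),
    hzero, ge_iff_le]
  calc _ = 1 / (n : ℝ) + 2 / n * cConst n *
        ∑ j ∈ Finset.univ.filter (fun j : Fin n => (j : ℕ) ≠ 0), lam j := by ring
    _ ≤ _ := by gcongr
end

section
/- For every integer n ≥ 3, c_n = cos² Δ_n, where c_n := max over 1 ≤ j ≤ n−1 and 0 ≤ k,l ≤ n−1 of S_j(k)·S_j(l) and Δ_n := min over integers m, t of |2πm/n − (2t+1)π/4|. Moreover this maximum is attained at some pair with k = l. -/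
open Real Matrix Finset

/-- `Δ_n`: the minimal distance `|2πm/n − (2t+1)π/4|` over integers `m, t`. -/
noncomputable def Delta (n : ℕ) : ℝ :=
  sInf {x : ℝ | ∃ m t : ℤ,
    x = |2 * Real.pi * (m : ℝ) / (n : ℝ) - (2 * (t : ℝ) + 1) * Real.pi / 4|}

/-- The minimum defining `Delta n` is attained. -/
theorem isLeast_Delta {n : ℕ} (hn : 0 < n) :
    IsLeast {x : ℝ | ∃ m t : ℤ,
      x = |2 * Real.pi * (m : ℝ) / (n : ℝ) - (2 * (t : ℝ) + 1) * Real.pi / 4|} (Delta n) := by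
  have hn' : (0 : ℝ) < n := by exact_mod_cast hn
  have key : ∀ m t : ℤ, |2 * Real.pi * (m : ℝ) / (n : ℝ) - (2 * (t : ℝ) + 1) * Real.pi / 4|
      = Real.pi / (4 * n) * ((8 * m - (2 * t + 1) * n : ℤ).natAbs : ℝ) := by
    intro m t
    rw [Nat.cast_natAbs, Int.cast_abs,
      ← abs_of_pos (show (0 : ℝ) < Real.pi / (4 * n) by positivity), ← abs_mul]
    congr 1
    push_cast
    field_simp
    ring
  let f : ℤ × ℤ → ℕ := fun p => (8 * p.1 - (2 * p.2 + 1) * n : ℤ).natAbs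
  obtain ⟨p, hp⟩ : ∃ p, ∀ q, f p ≤ f q :=
    ⟨Function.argmin f, fun q => Function.argmin_le f q⟩
  have h : IsLeast {x : ℝ | ∃ m t : ℤ,
      x = |2 * Real.pi * (m : ℝ) / (n : ℝ) - (2 * (t : ℝ) + 1) * Real.pi / 4|}
      (Real.pi / (4 * n) * (f p : ℝ)) := by
    refine ⟨⟨p.1, p.2, (key p.1 p.2).symm⟩, ?_⟩
    rintro x ⟨m, t, rfl⟩
    rw [key]
    have : (f p : ℝ) ≤ (f (m, t) : ℝ) := by exact_mod_cast hp (m, t)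
    exact mul_le_mul_of_nonneg_left this (by positivity)
  rw [Delta, h.csInf_eq]
  exact h

theorem cos_sub_int_mul_pi_sq (x : ℝ) (s : ℤ) :
    Real.cos (x - s * Real.pi) ^ 2 = Real.cos x ^ 2 := by
  rw [Real.cos_sub_int_mul_pi, mul_pow, ← zpow_natCast, ← _root_.zpow_mul, mul_comm s,
    _root_.zpow_mul]
  norm_num

theorem sin_sq_le_cos_Delta_sq {n : ℕ} (hn : 0 < n) (m : ℤ) :
    Real.sin (2 * Real.pi * m / n + Real.pi / 4) ^ 2 ≤ Real.cos (Delta n) ^ 2 := by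
  obtain ⟨hmem, hle⟩ := isLeast_Delta hn
  have hnonneg : 0 ≤ Delta n := by
    obtain ⟨a, b, h⟩ := hmem
    rw [h]
    positivity
  set z : ℝ := 2 * Real.pi * m / n - Real.pi / 4 with hz
  have hsz : |z - round (z / Real.pi) * Real.pi| ≤ Real.pi / 2 := by
    have h := abs_sub_round (z / Real.pi)
    have heq : z - round (z / Real.pi) * Real.pi
        = (z / Real.pi - round (z / Real.pi)) * Real.pi := by
      field_simp
    rw [heq, abs_mul, abs_of_pos Real.pi_pos]
    nlinarith [Real.pi_pos]
  have hD : Delta n ≤ |z - round (z / Real.pi) * Real.pi| := by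
    refine hle ⟨m, 2 * round (z / Real.pi), ?_⟩
    congr 1
    rw [hz]
    push_cast
    ring
  have hcos : Real.cos |z - round (z / Real.pi) * Real.pi| ≤ Real.cos (Delta n) :=
    Real.cos_le_cos_of_nonneg_of_le_pi hnonneg (by linarith [Real.pi_pos]) hD
  have hcos0 : 0 ≤ Real.cos |z - round (z / Real.pi) * Real.pi| :=
    Real.cos_nonneg_of_neg_pi_div_two_le_of_le
      (by linarith [abs_nonneg (z - round (z / Real.pi) * Real.pi), Real.pi_pos]) hsz
  have hsq : Real.sin (2 * Real.pi * m / n + Real.pi / 4) ^ 2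
      = Real.cos |z - round (z / Real.pi) * Real.pi| ^ 2 := by
    rw [Real.cos_abs, cos_sub_int_mul_pi_sq,
      show 2 * Real.pi * m / n + Real.pi / 4 = z + Real.pi / 2 by rw [hz]; ring,
      Real.sin_add_pi_div_two]
  rw [hsq]
  exact pow_le_pow_left₀ hcos0 hcos 2

theorem exists_sin_sq_eq_cos_Delta_sq {n : ℕ} (hn : 0 < n) :
    ∃ m : ℤ, Real.sin (2 * Real.pi * m / n + Real.pi / 4) ^ 2 = Real.cos (Delta n) ^ 2 := by
  obtain ⟨⟨m, t, h⟩, -⟩ := isLeast_Delta hn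
  rw [h, Real.cos_abs]
  obtain ⟨s, rfl | rfl⟩ := Int.even_or_odd' t
  · refine ⟨m, ?_⟩
    rw [show 2 * Real.pi * m / n - (2 * ((2 * s : ℤ) : ℝ) + 1) * Real.pi / 4
        = (2 * Real.pi * m / n - Real.pi / 4) - s * Real.pi by push_cast; ring,
      cos_sub_int_mul_pi_sq,
      ← Real.sin_add_pi_div_two]
    congr 2
    ring
  · refine ⟨-m, ?_⟩
    rw [show 2 * Real.pi * m / n - (2 * ((2 * s + 1 : ℤ) : ℝ) + 1) * Real.pi / 4
        = (2 * Real.pi * m / n + Real.pi / 4) - ((s + 1 : ℤ) : ℝ) * Real.pi by push_cast; ring,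
      cos_sub_int_mul_pi_sq, ← Real.sin_pi_div_two_sub]
    congr 2
    push_cast
    ring

theorem sin_emod {n : ℕ} (hn : 0 < n) (m : ℤ) :
    Real.sin (2 * Real.pi * ((m % n : ℤ) : ℝ) / n + Real.pi / 4)
      = Real.sin (2 * Real.pi * m / n + Real.pi / 4) := by
  have hn' : (n : ℝ) ≠ 0 := by exact_mod_cast hn.ne'
  have hm : (m : ℝ) = ((m % n : ℤ) : ℝ) + n * ((m / n : ℤ) : ℝ) := by
    exact_mod_cast (Int.emod_add_mul_ediv m n).symm
  rw [← Real.sin_add_int_mul_two_pi _ (m / n)]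
  congr 1
  rw [hm]
  field_simp
  ring

theorem stmt2 (n : ℕ) (hn : 3 ≤ n) :
    cConst n = Real.cos (Delta n) ^ 2 ∧
      ∃ j k : Fin n, (j : ℕ) ≠ 0 ∧ S n j k * S n j k = cConst n := by
  have hpos : 0 < n := by omega
  have hS : ∀ j k : ℕ, S n j k ^ 2 ≤ Real.cos (Delta n) ^ 2 := by
    intro j k
    have h := sin_sq_le_cos_Delta_sq hpos (j * k)
    push_cast at h
    rwa [← mul_assoc] at h
  obtain ⟨j, k, hj, hjk⟩ : ∃ j k : Fin n, (j : ℕ) ≠ 0 ∧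
      S n j k * S n j k = Real.cos (Delta n) ^ 2 := by
    obtain ⟨m, hm⟩ := exists_sin_sq_eq_cos_Delta_sq hpos
    have h0 : 0 ≤ m % n := Int.emod_nonneg _ (by omega)
    have h1 : m % n < n := Int.emod_lt_of_pos _ (by omega)
    refine ⟨⟨1, by omega⟩, ⟨(m % n).toNat, by omega⟩, one_ne_zero, ?_⟩
    have hcast : (((m % n).toNat : ℕ) : ℝ) = ((m % n : ℤ) : ℝ) := by
      exact_mod_cast congrArg (Int.cast : ℤ → ℝ) (Int.toNat_of_nonneg h0)
    rw [← hm, ← sin_emod hpos, ← pow_two, S, hcast, Nat.cast_one, mul_one]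
  have hmax : IsGreatest {x : ℝ | ∃ j k l : Fin n, (j : ℕ) ≠ 0 ∧ x = S n j k * S n j l}
      (Real.cos (Delta n) ^ 2) := by
    refine ⟨⟨j, k, k, hj, hjk.symm⟩, ?_⟩
    rintro x ⟨j', k', l', -, rfl⟩
    nlinarith [hS j' k', hS j' l', sq_nonneg (S n j' k' - S n j' l')]
  have hc : cConst n = Real.cos (Delta n) ^ 2 := hmax.csSup_eq
  exact ⟨hc, j, k, hj, hjk.trans hc.symm⟩
end

section
/- Let n ≥ 3 and let (λ_0, λ_1, …, λ_{n−1}) be a real list with λ_0 = 1 and λ_j ∈ [−1, 0] for 1 ≤ j ≤ n−1. If 1 + ∑_{j=1}^{n−1} λ_j > δ_n, where δ_n := 1 − 1/(2·cos² Δ_n) and Δ_n := min over integers m, t of |2πm/n − (2t+1)π/4|, then P(Λ) = Q Λ Qᵀ (with Q the canonical cycle basis and Λ = diag(λ_0,…,λ_{n−1})) is a symmetric doubly stochastic matrix. -/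
open Real Matrix Finset

/-- `δ_n := 1 − 1/(2 cos² Δ_n)`. -/
noncomputable def deltaCycle (n : ℕ) : ℝ :=
  1 - 1 / (2 * Real.cos (Delta n) ^ 2)

/-- Sampled over a full period, a phase-shifted sine of nontrivial integer frequency sums to zero. -/
theorem sum_sin_two_pi_mul_div_add_eq_zero {n j : ℕ} (hj0 : 0 < j) (hjn : j < n) (φ : ℝ) :
    ∑ k : Fin n, Real.sin (2 * Real.pi * (j : ℝ) * ((k : ℕ) : ℝ) / (n : ℝ) + φ) = 0 := by
  have hn : (0 : ℝ) < n := by exact_mod_cast hj0.trans hjn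
  have hj : (0 : ℝ) < j := by exact_mod_cast hj0
  have hjn' : (j : ℝ) < n := by exact_mod_cast hjn
  have hs : 0 < Real.sin (Real.pi * j / n) := by
    apply Real.sin_pos_of_pos_of_lt_pi
    · have := Real.pi_pos
      positivity
    · rw [div_lt_iff₀ hn]
      exact mul_lt_mul_of_pos_left hjn' Real.pi_pos
  rw [Fin.sum_univ_eq_sum_range
    (fun k : ℕ => Real.sin (2 * Real.pi * (j : ℝ) * (k : ℝ) / (n : ℝ) + φ))]
  set f : ℕ → ℝ := fun k =>
    -Real.cos (2 * Real.pi * (j : ℝ) * (k : ℝ) / (n : ℝ) + φ - Real.pi * j / n) with hf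
  have step : ∀ k : ℕ, 2 * Real.sin (Real.pi * j / n) *
      Real.sin (2 * Real.pi * (j : ℝ) * (k : ℝ) / (n : ℝ) + φ) = f (k + 1) - f k := by
    intro k
    have h : 2 * Real.pi * (j : ℝ) * ((k + 1 : ℕ) : ℝ) / (n : ℝ) + φ - Real.pi * j / n
        = (2 * Real.pi * (j : ℝ) * (k : ℝ) / (n : ℝ) + φ) + Real.pi * j / n := by
      push_cast
      ring
    simp only [hf]
    rw [h, Real.cos_add, Real.cos_sub]
    ring
  have hper : f n = f 0 := by
    have h : 2 * Real.pi * (j : ℝ) * (n : ℝ) / (n : ℝ) + φ - Real.pi * j / n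
        = (2 * Real.pi * (j : ℝ) * ((0 : ℕ) : ℝ) / (n : ℝ) + φ - Real.pi * j / n)
          + j * (2 * Real.pi) := by
      field_simp
      push_cast
      ring
    simp only [hf]
    rw [h, Real.cos_add_nat_mul_two_pi]
  have hsum := Finset.sum_range_sub f n
  rw [hper, sub_self, ← Finset.sum_congr rfl (fun k _ => step k), ← Finset.mul_sum] at hsum
  exact (mul_eq_zero.mp hsum).resolve_left (by positivity)

theorem Delta_le (n : ℕ) (m t : ℤ) :
    Delta n ≤ |2 * Real.pi * (m : ℝ) / (n : ℝ) - (2 * (t : ℝ) + 1) * Real.pi / 4| :=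
  csInf_le ⟨0, by rintro x ⟨m, t, rfl⟩; exact abs_nonneg _⟩ ⟨m, t, rfl⟩

theorem Delta_nonneg (n : ℕ) : 0 ≤ Delta n :=
  Real.sInf_nonneg (by rintro x ⟨m, t, rfl⟩; exact abs_nonneg _)

theorem Delta_le_pi_div_four (n : ℕ) : Delta n ≤ Real.pi / 4 := by
  refine (Delta_le n 0 0).trans (le_of_eq ?_)
  rw [show 2 * Real.pi * ((0 : ℤ) : ℝ) / (n : ℝ) - (2 * ((0 : ℤ) : ℝ) + 1) * Real.pi / 4
    = -(Real.pi / 4) by simp, abs_neg, abs_of_pos (by have := Real.pi_pos; positivity)]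

theorem cos_Delta_pos (n : ℕ) : 0 < Real.cos (Delta n) := by
  have := Real.pi_pos
  have := Delta_nonneg n
  have := Delta_le_pi_div_four n
  exact Real.cos_pos_of_mem_Ioo ⟨by linarith, by linarith⟩

theorem abs_sin_le_cos_Delta (n : ℕ) (m : ℤ) :
    |Real.sin (2 * Real.pi * (m : ℝ) / (n : ℝ) + Real.pi / 4)| ≤ Real.cos (Delta n) := by
  have hpi := Real.pi_pos
  set y : ℝ := 2 * Real.pi * (m : ℝ) / (n : ℝ) - Real.pi / 4 with hy
  set r : ℤ := round (y / Real.pi) with hr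
  have hsin : Real.sin (2 * Real.pi * (m : ℝ) / (n : ℝ) + Real.pi / 4) = Real.cos y := by
    rw [← Real.sin_add_pi_div_two, hy]
    congr 1
    ring
  have hle : |y - r * Real.pi| ≤ Real.pi / 2 := by
    have h := abs_sub_round (y / Real.pi)
    have h' : y - r * Real.pi = (y / Real.pi - r) * Real.pi := by field_simp
    rw [h', abs_mul, abs_of_pos hpi]
    nlinarith
  have hge : Delta n ≤ |y - r * Real.pi| := by
    have h := Delta_le n m (2 * r)
    convert h using 2
    push_cast
    rw [hy]
    ring
  have habs : |Real.cos y| = Real.cos |y - r * Real.pi| := by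
    rw [Real.cos_abs, ← abs_of_nonneg (Real.cos_nonneg_of_neg_pi_div_two_le_of_le
      (by linarith [(abs_le.mp hle).1]) (abs_le.mp hle).2), Real.cos_sub_int_mul_pi, abs_mul,
      abs_zpow, abs_neg, abs_one, _root_.one_zpow, one_mul]
  rw [hsin, habs]
  exact Real.cos_le_cos_of_nonneg_of_le_pi (Delta_nonneg n) (by linarith) hge

theorem cycleQ_mul_cycleQ_le {n : ℕ} (k l j : Fin n) (hj : (j : ℕ) ≠ 0) :
    cycleQ n k j * cycleQ n l j ≤ 2 / n * Real.cos (Delta n) ^ 2 := by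
  have hbound : ∀ i : Fin n, |Real.sin (2 * Real.pi * ((j : ℕ) : ℝ) * ((i : ℕ) : ℝ) / (n : ℝ)
      + Real.pi / 4)| ≤ Real.cos (Delta n) := by
    intro i
    have h := abs_sin_le_cos_Delta n ((j : ℕ) * (i : ℕ) : ℤ)
    push_cast at h
    rwa [← mul_assoc] at h
  simp only [cycleQ, Matrix.of_apply, if_neg hj]
  rw [mul_mul_mul_comm, Real.mul_self_sqrt (by positivity), sq]
  refine mul_le_mul_of_nonneg_left ((le_abs_self _).trans ?_) (by positivity)
  rw [abs_mul]
  exact mul_le_mul (hbound k) (hbound l) (abs_nonneg _) (cos_Delta_pos n).le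

theorem sum_cycleQ_col {n : ℕ} (j : Fin n) :
    ∑ k, cycleQ n k j = if (j : ℕ) = 0 then Real.sqrt n else 0 := by
  split_ifs with hj
  · simp [cycleQ, hj, ← div_eq_mul_inv, Real.div_sqrt]
  · simp only [cycleQ, Matrix.of_apply, if_neg hj]
    rw [← Finset.mul_sum, sum_sin_two_pi_mul_div_add_eq_zero (Nat.pos_of_ne_zero hj) j.2, mul_zero]

theorem cycleQ_mul_diagonal_mul_transpose_apply {n : ℕ} (lam : Fin n → ℝ) (k l : Fin n) :
    (cycleQ n * Matrix.diagonal lam * (cycleQ n)ᵀ) k l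
      = ∑ j, lam j * (cycleQ n k j * cycleQ n l j) := by
  rw [Matrix.mul_apply]
  refine Finset.sum_congr rfl fun j _ => ?_
  rw [Matrix.mul_diagonal, Matrix.transpose_apply]
  ring

theorem stmt5 (n : ℕ) (hn : 3 ≤ n) (lam : Fin n → ℝ)
    (h0 : ∀ j : Fin n, (j : ℕ) = 0 → lam j = 1)
    (hrange : ∀ j : Fin n, (j : ℕ) ≠ 0 → lam j ∈ Set.Icc (-1 : ℝ) 0)
    (hsum : 1 + ∑ j ∈ Finset.univ.filter (fun j : Fin n => (j : ℕ) ≠ 0), lam j > deltaCycle n) :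
    (cycleQ n * Matrix.diagonal lam * (cycleQ n)ᵀ)ᵀ
        = cycleQ n * Matrix.diagonal lam * (cycleQ n)ᵀ ∧
      (∀ k l : Fin n, 0 ≤ (cycleQ n * Matrix.diagonal lam * (cycleQ n)ᵀ) k l) ∧
      (∀ k : Fin n, ∑ l : Fin n, (cycleQ n * Matrix.diagonal lam * (cycleQ n)ᵀ) k l = 1) ∧
      (∀ l : Fin n, ∑ k : Fin n, (cycleQ n * Matrix.diagonal lam * (cycleQ n)ᵀ) k l = 1) := by
  have hpos : 0 < n := by omega
  have hnR : (0 : ℝ) < n := by exact_mod_cast hpos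
  set P := cycleQ n * Matrix.diagonal lam * (cycleQ n)ᵀ with hP
  have hsymm : Pᵀ = P := by
    simp [hP, Matrix.transpose_mul, Matrix.mul_assoc]
  have hfilter : Finset.univ.filter (fun j : Fin n => (j : ℕ) = 0) = {⟨0, hpos⟩} := by
    ext j
    simp [Fin.ext_iff]
  have hrow : ∀ k : Fin n, ∑ l, P k l = 1 := by
    intro k
    simp only [hP, cycleQ_mul_diagonal_mul_transpose_apply]
    rw [Finset.sum_comm]
    simp only [← Finset.mul_sum, sum_cycleQ_col, mul_ite, mul_zero]
    rw [← Finset.sum_filter, hfilter, Finset.sum_singleton, h0 _ rfl]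
    simp [cycleQ, hnR.ne']
  refine ⟨hsymm, fun k l => ?_, hrow, fun l => ?_⟩
  · rw [hP, cycleQ_mul_diagonal_mul_transpose_apply,
      ← Finset.sum_filter_add_sum_filter_not _ (fun j : Fin n => (j : ℕ) = 0), hfilter,
      Finset.sum_singleton, h0 _ rfl]
    have hfirst : cycleQ n k ⟨0, hpos⟩ * cycleQ n l ⟨0, hpos⟩ = 1 / n := by
      simp [cycleQ, ← mul_inv]
    have hrest : (∑ j ∈ Finset.univ.filter (fun j : Fin n => (j : ℕ) ≠ 0), lam j)
        * (2 / n * Real.cos (Delta n) ^ 2)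
        ≤ ∑ j ∈ Finset.univ.filter (fun j : Fin n => (j : ℕ) ≠ 0),
          lam j * (cycleQ n k j * cycleQ n l j) := by
      rw [Finset.sum_mul]
      refine Finset.sum_le_sum fun j hj => ?_
      have hj0 := (Finset.mem_filter.mp hj).2
      exact mul_le_mul_of_nonpos_left (cycleQ_mul_cycleQ_le k l j hj0) (hrange j hj0).2
    have hcos := cos_Delta_pos n
    have hsum' : -(1 / (2 * Real.cos (Delta n) ^ 2))
        ≤ ∑ j ∈ Finset.univ.filter (fun j : Fin n => (j : ℕ) ≠ 0), lam j := by
      unfold deltaCycle at hsum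
      linarith
    have hmul := mul_le_mul_of_nonneg_right hsum'
      (show 0 ≤ 2 / (n : ℝ) * Real.cos (Delta n) ^ 2 by positivity)
    have hleft : -(1 / (2 * Real.cos (Delta n) ^ 2)) * (2 / (n : ℝ) * Real.cos (Delta n) ^ 2)
        = -(1 / n) := by
      field_simp
    rw [hfirst, one_mul]
    linarith
  · rw [← hrow l]
    exact Finset.sum_congr rfl fun k _ => congrFun (congrFun hsymm l) k
end

section
/- For every integer n ≥ 3 there exist indices j* ∈ {1,…,n−1} and k* ∈ {0,…,n−1} with the following property: for every real t < 0, if Λ = diag(λ_0,…,λ_{n−1}) with λ_0 = 1, λ_{j*} = t, and λ_j = 0 for all other j, then the (k*,k*) entry of Q Λ Qᵀ (with Q the canonical cycle basis) equals (1/n)·(1 + 2·t·cos² Δ_n), and this entry is nonnegative if and only if t ≥ −1/(2·cos² Δ_n). -/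
open Real Matrix Finset

theorem exists_Delta_eq (n : ℕ) (hn : 0 < n) :
    ∃ m t : ℤ, Delta n =
      |2 * Real.pi * (m : ℝ) / (n : ℝ) - (2 * (t : ℝ) + 1) * Real.pi / 4| := by
  have hnR : (0 : ℝ) < n := by exact_mod_cast hn
  have key : ∀ m t : ℤ, |2 * Real.pi * (m : ℝ) / (n : ℝ) - (2 * (t : ℝ) + 1) * Real.pi / 4|
      = Real.pi / (4 * n) * ((8 * m - (2 * t + 1) * n : ℤ).natAbs : ℝ) := by
    intro m t
    rw [Nat.cast_natAbs, Int.cast_abs, ← abs_of_pos (show 0 < Real.pi / (4 * n) by positivity),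
      ← abs_mul]
    congr 1
    push_cast
    field_simp
    ring
  obtain ⟨⟨m, t⟩, hmin⟩ := exists_minimalFor_of_wellFoundedLT (fun _ : ℤ × ℤ => True)
    (fun p : ℤ × ℤ => (8 * p.1 - (2 * p.2 + 1) * n : ℤ).natAbs) ⟨(0, 0), trivial⟩
  refine ⟨m, t, IsLeast.csInf_eq ⟨⟨m, t, rfl⟩, ?_⟩⟩
  rintro x ⟨a, b, rfl⟩
  rw [key, key]
  refine mul_le_mul_of_nonneg_left ?_ (by positivity)
  have h := (le_total (8 * m - (2 * t + 1) * n : ℤ).natAbs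
    (8 * a - (2 * b + 1) * n : ℤ).natAbs).elim id
    fun h => hmin.2 (j := (a, b)) trivial h
  exact_mod_cast h

theorem cos_sub_pi_div_four_add_int_mul_pi_sq (x : ℝ) (s : ℤ) :
    Real.cos (x - (Real.pi / 4 + s * Real.pi)) ^ 2 = Real.sin (x + Real.pi / 4) ^ 2 := by
  rw [← sub_sub, Real.cos_sub_int_mul_pi, mul_pow]
  have h1 : (((-1 : ℝ) ^ s) ^ 2) = 1 := by
    rcases Int.even_or_odd s with h | h
    · simp [h.neg_one_zpow]
    · simp [h.neg_one_zpow]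
  rw [h1, one_mul, ← Real.cos_pi_div_two_sub, ← Real.cos_neg]
  ring_nf

theorem exists_int_sin_sq_eq_cos_Delta_sq (n : ℕ) (hn : 0 < n) :
    ∃ m : ℤ, Real.sin (2 * Real.pi * (m : ℝ) / n + Real.pi / 4) ^ 2
      = Real.cos (Delta n) ^ 2 := by
  obtain ⟨m, t, h⟩ := exists_Delta_eq n hn
  rw [h, Real.cos_abs]
  rcases Int.even_or_odd' t with ⟨s, rfl | rfl⟩
  · refine ⟨m, ?_⟩
    rw [← cos_sub_pi_div_four_add_int_mul_pi_sq _ s]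
    push_cast
    ring_nf
  · refine ⟨-m, ?_⟩
    rw [← cos_sub_pi_div_four_add_int_mul_pi_sq _ (-s - 1), ← Real.cos_neg]
    push_cast
    ring_nf

theorem exists_fin_sin_sq_eq_cos_Delta_sq (n : ℕ) (hn : 0 < n) :
    ∃ k : Fin n, Real.sin (2 * Real.pi * ((k : ℕ) : ℝ) / n + Real.pi / 4) ^ 2
      = Real.cos (Delta n) ^ 2 := by
  obtain ⟨m, h⟩ := exists_int_sin_sq_eq_cos_Delta_sq n hn
  have hn0 : (n : ℝ) ≠ 0 := by exact_mod_cast hn.ne'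
  have hnonneg : 0 ≤ m % (n : ℤ) := Int.emod_nonneg _ (by omega)
  have hlt : m % (n : ℤ) < n := Int.emod_lt_of_pos _ (by omega)
  refine ⟨⟨(m % (n : ℤ)).toNat, by omega⟩, ?_⟩
  have hcast : (((m % (n : ℤ)).toNat : ℕ) : ℝ) = ((m % (n : ℤ) : ℤ) : ℝ) := by
    exact_mod_cast congrArg (Int.cast : ℤ → ℝ) (Int.toNat_of_nonneg hnonneg)
  have hm : (m : ℝ) = ((m % (n : ℤ) : ℤ) : ℝ) + n * ((m / (n : ℤ) : ℤ) : ℝ) := by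
    exact_mod_cast (Int.emod_add_mul_ediv m n).symm
  rw [← h, hm, hcast, ← Real.sin_add_int_mul_two_pi _ (m / (n : ℤ))]
  congr 2
  field_simp
  ring


theorem stmt7 (n : ℕ) (hn : 3 ≤ n) :
    ∃ jstar kstar : Fin n, (jstar : ℕ) ≠ 0 ∧
      ∀ t : ℝ, t < 0 → ∀ lam : Fin n → ℝ,
        (∀ j : Fin n, (j : ℕ) = 0 → lam j = 1) →
        lam jstar = t →
        (∀ j : Fin n, (j : ℕ) ≠ 0 → j ≠ jstar → lam j = 0) →
        (cycleQ n * Matrix.diagonal lam * (cycleQ n)ᵀ) kstar kstar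
            = (1 / n) * (1 + 2 * t * Real.cos (Delta n) ^ 2) ∧
          (0 ≤ (cycleQ n * Matrix.diagonal lam * (cycleQ n)ᵀ) kstar kstar
            ↔ -(1 / (2 * Real.cos (Delta n) ^ 2)) ≤ t) := by
  have hnR : (0 : ℝ) < n := by
    have : 0 < n := by omega
    exact_mod_cast this
  obtain ⟨k, hk⟩ := exists_fin_sin_sq_eq_cos_Delta_sq n (by omega)
  refine ⟨⟨1, by omega⟩, k, one_ne_zero, fun t _ lam h0 h1 hz => ?_⟩
  have hentry : (cycleQ n * Matrix.diagonal lam * (cycleQ n)ᵀ) k k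
      = (1 / n) * (1 + 2 * t * Real.cos (Delta n) ^ 2) := by
    rw [Matrix.mul_apply, Finset.sum_eq_add (⟨0, by omega⟩ : Fin n) ⟨1, by omega⟩ (by simp)
      (fun j _ hj => by
        rw [Matrix.mul_diagonal, hz j (fun h => hj.1 (Fin.ext h)) hj.2]
        simp) (by simp) (by simp)]
    rw [Matrix.mul_diagonal, Matrix.mul_diagonal, h1, h0 _ rfl, ← hk]
    have hs : Real.sqrt n ^ 2 = n := Real.sq_sqrt hnR.le
    have hs2 : Real.sqrt (2 / n) ^ 2 = 2 / n := Real.sq_sqrt (by positivity)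
    have hQQ : ∀ a b : ℝ, 1 / Real.sqrt n * 1 * (1 / Real.sqrt n)
        + Real.sqrt (2 / n) * a * b * (Real.sqrt (2 / n) * a)
        = 1 / Real.sqrt n ^ 2 + Real.sqrt (2 / n) ^ 2 * b * a ^ 2 := by
      intro a b
      ring
    simp only [cycleQ, Matrix.transpose_apply, Matrix.of_apply, if_true, one_ne_zero, if_false,
      Nat.cast_one, mul_one (2 * Real.pi)]
    rw [hQQ, hs, hs2]
    ring
  refine ⟨hentry, ?_⟩
  have hc : 0 < 2 * Real.cos (Delta n) ^ 2 := by
    have := cos_Delta_pos n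
    positivity
  rw [hentry, mul_nonneg_iff_of_pos_left (by positivity), neg_le, le_div_iff₀ hc]
  constructor <;> intro h <;> linarith
end

section
/- For every real number x, max{|sin x|, |cos x|} = cos(dist(x, A)), where A := {m·π/2 : m ∈ ℤ} and dist(x, A) denotes the distance from x to the nearest point of A. -/
open Real

theorem periodic_max_abs_sin_abs_cos :
    Function.Periodic (fun x : ℝ => max |Real.sin x| |Real.cos x|) (Real.pi / 2) := by
  intro x
  simp only [Real.sin_add_pi_div_two, Real.cos_add_pi_div_two, abs_neg, max_comm]

theorem max_abs_sin_abs_cos_of_abs_le_pi_div_four {t : ℝ} (ht : |t| ≤ Real.pi / 4) :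
    max |Real.sin t| |Real.cos t| = Real.cos |t| := by
  have h0 := abs_nonneg t
  have hpi := Real.pi_pos
  have hsin : |Real.sin t| = Real.sin |t| :=
    Real.abs_sin_eq_sin_abs_of_abs_le_pi (by linarith)
  have hcos : 0 ≤ Real.cos |t| := Real.cos_nonneg_of_mem_Icc ⟨by linarith, by linarith⟩
  rw [hsin, ← Real.cos_abs t, abs_of_nonneg hcos, max_eq_right_iff,
    ← Real.sin_pi_div_two_sub]
  exact Real.sin_le_sin_of_le_of_le_pi_div_two (by linarith) (by linarith) (by linarith)

theorem abs_sub_intCast_mul_eq {c : ℝ} (hc : 0 < c) (x : ℝ) (m : ℤ) :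
    |x - m * c| = |x / c - m| * c := by
  rw [← abs_of_pos hc, ← abs_mul, abs_of_pos hc, sub_mul, div_mul_cancel₀ x hc.ne']

theorem infDist_int_multiples {c : ℝ} (hc : 0 < c) (x : ℝ) :
    Metric.infDist x {y : ℝ | ∃ m : ℤ, y = (m : ℝ) * c} = |x - round (x / c) * c| := by
  apply le_antisymm
  · exact Metric.infDist_le_dist_of_mem ⟨round (x / c), rfl⟩
  · have hne : {y : ℝ | ∃ m : ℤ, y = (m : ℝ) * c}.Nonempty := ⟨_, 0, rfl⟩
    rw [Metric.le_infDist hne]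
    rintro _ ⟨m, rfl⟩
    rw [Real.dist_eq, abs_sub_intCast_mul_eq hc, abs_sub_intCast_mul_eq hc]
    exact mul_le_mul_of_nonneg_right (round_le _ m) hc.le

theorem stmt8 (x : ℝ) :
    max |Real.sin x| |Real.cos x|
      = Real.cos (Metric.infDist x {y : ℝ | ∃ m : ℤ, y = (m : ℝ) * (Real.pi / 2)}) := by
  have hc := Real.pi_div_two_pos
  rw [infDist_int_multiples hc, ← max_abs_sin_abs_cos_of_abs_le_pi_div_four]
  · exact (periodic_max_abs_sin_abs_cos.sub_int_mul_eq _).symm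
  · rw [abs_sub_intCast_mul_eq hc]
    nlinarith [abs_sub_round (x / (Real.pi / 2))]
end

section
/- Let n ≥ 3 and 1 ≤ j ≤ ⌊(n−1)/2⌋, and set n' := n/gcd(j,n). Then the minimum over real phases φ of max{ ‖w_j^{(φ)}‖_∞ , ‖w̃_j^{(φ)}‖_∞ } equals √(2/n)·cos(Δ*(n')), where Δ*(m) := π/m if m ≡ 0 (mod 4), π/(2m) if m ≡ 2 (mod 4), and π/(4m) if m is odd. -/
open Real

/-- `w_j^{(φ)}(k) = √(2/n)·sin(2πjk/n + φ)`. -/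
noncomputable def wvec (n j : ℕ) (φ : ℝ) : Fin n → ℝ :=
  fun k => Real.sqrt (2 / n) * Real.sin (2 * Real.pi * (j : ℝ) * ((k : ℕ) : ℝ) / (n : ℝ) + φ)

/-- `w̃_j^{(φ)}(k) = √(2/n)·cos(2πjk/n + φ)`. -/
noncomputable def wtvec (n j : ℕ) (φ : ℝ) : Fin n → ℝ :=
  fun k => Real.sqrt (2 / n) * Real.cos (2 * Real.pi * (j : ℝ) * ((k : ℕ) : ℝ) / (n : ℝ) + φ)

/-- `Δ*(m)`: `π/m` if `m ≡ 0 (mod 4)`, `π/(2m)` if `m ≡ 2 (mod 4)`, `π/(4m)` if `m` odd. -/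
noncomputable def DeltaStar (m : ℕ) : ℝ :=
  if m % 4 = 0 then Real.pi / m
  else if m % 4 = 2 then Real.pi / (2 * m)
  else Real.pi / (4 * m)

theorem gcd_four_mul_eq (n j : ℕ) (hn : 0 < n) :
    Nat.gcd (4 * j) n = Nat.gcd j n * Nat.gcd 4 (n / Nat.gcd j n) := by
  have hg : 0 < Nat.gcd j n := Nat.gcd_pos_of_pos_right _ hn
  have hcop := Nat.coprime_div_gcd_div_gcd hg
  obtain ⟨a, ha⟩ := Nat.gcd_dvd_left j n
  obtain ⟨m, hm⟩ := Nat.gcd_dvd_right j n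
  set g := Nat.gcd j n
  have ha' : j / g = a := by rw [ha, Nat.mul_div_cancel_left _ hg]
  have hm' : n / g = m := by rw [hm, Nat.mul_div_cancel_left _ hg]
  rw [ha', hm'] at hcop
  calc Nat.gcd (4 * j) n = Nat.gcd (g * (4 * a)) (g * m) := by
        rw [← hm, ← Nat.mul_left_comm, ← ha]
    _ = g * Nat.gcd (4 * a) m := Nat.gcd_mul_left _ _ _
    _ = g * Nat.gcd 4 (n / g) := by rw [hm', Nat.Coprime.gcd_mul_right_cancel 4 hcop]

theorem deltaStar_eq (m : ℕ) : DeltaStar m = Nat.gcd 4 m * π / (4 * m) := by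
  have key : Nat.gcd 4 m = Nat.gcd (m % 4) 4 := Nat.gcd_rec 4 m
  have hlt : m % 4 < 4 := Nat.mod_lt _ (by norm_num)
  unfold DeltaStar
  rw [key]
  rcases Nat.eq_zero_or_pos m with rfl | hm
  · simp
  have hm' : (m : ℝ) ≠ 0 := by positivity
  interval_cases m % 4 <;> norm_num <;> field_simp; norm_num

theorem deltaStar_div_gcd (n j : ℕ) (hn : 0 < n) :
    DeltaStar (n / Nat.gcd j n) = Nat.gcd (4 * j) n * π / (4 * n) := by
  have hg : 0 < Nat.gcd j n := Nat.gcd_pos_of_pos_right _ hn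
  have hn' : (n : ℝ) ≠ 0 := by positivity
  have hg' : (Nat.gcd j n : ℝ) ≠ 0 := by positivity
  rw [deltaStar_eq, gcd_four_mul_eq n j hn, Nat.cast_div (Nat.gcd_dvd_right j n) hg']
  push_cast
  field_simp

theorem abs_cos_sub_int_mul_pi_div_two_le (x : ℝ) (l : ℤ) :
    |cos (x - l * (π / 2))| ≤ max |sin x| |cos x| := by
  rcases Int.even_or_odd' l with ⟨c, rfl | rfl⟩
  · have h : x - ((2 * c : ℤ) : ℝ) * (π / 2) = x - c * π := by push_cast; ring
    rw [h, cos_sub_int_mul_pi, abs_mul, abs_neg_one_zpow, one_mul]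
    exact le_max_right _ _
  · have h : x - ((2 * c + 1 : ℤ) : ℝ) * (π / 2) = x - π / 2 - c * π := by push_cast; ring
    rw [h, cos_sub_int_mul_pi, abs_mul, abs_neg_one_zpow, one_mul, cos_sub_pi_div_two]
    exact le_max_left _ _

/-- Odd multiples of `π / (2 * b)` stay at distance at least `π / (2 * b)` from `2πℤ`. -/
theorem cos_odd_mul_pi_div_le (b : ℕ) (hb : 0 < b) (a : ℤ) :
    cos ((2 * a + 1) * (π / (2 * b))) ≤ cos (π / (2 * b)) := by
  have hb' : (0 : ℝ) < b := by positivity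
  have hbz : (0 : ℤ) < 2 * b := by positivity
  set β := π / (2 * b) with hβ
  have hβ0 : 0 < β := by positivity
  have hπ : π = 2 * b * β := by rw [hβ]; field_simp
  have hr0 : (0 : ℝ) ≤ (a % (2 * b) : ℤ) := by exact_mod_cast Int.emod_nonneg a hbz.ne'
  have hr1 : ((a % (2 * b) : ℤ) : ℝ) + 1 ≤ 2 * b := by exact_mod_cast Int.emod_lt_of_pos a hbz
  have ha : (a : ℝ) = (a % (2 * b) : ℤ) + 2 * b * (a / (2 * b) : ℤ) := by
    exact_mod_cast (Int.emod_add_mul_ediv a (2 * b)).symm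
  set r : ℝ := ((a % (2 * b) : ℤ) : ℝ)
  have hred : (2 * a + 1) * β = (2 * r + 1) * β + (a / (2 * b) : ℤ) * (2 * π) := by
    rw [hπ, ha]; ring
  rw [hred, cos_add_int_mul_two_pi]
  rcases le_total ((2 * r + 1) * β) π with h | h
  · exact cos_le_cos_of_nonneg_of_le_pi hβ0.le h (by nlinarith)
  · rw [← cos_two_pi_sub]
    exact cos_le_cos_of_nonneg_of_le_pi hβ0.le (by linarith) (by nlinarith)

theorem abs_cos_odd_mul_pi_div_le (b : ℕ) (hb : 0 < b) (a : ℤ) :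
    |cos ((2 * a + 1) * (π / (4 * b)))| ≤ cos (π / (4 * b)) := by
  have hb1 : (1 : ℝ) ≤ b := by exact_mod_cast hb
  have hle : π / (4 * b) ≤ π / 2 := by gcongr; linarith
  have hnn : 0 ≤ cos (π / (4 * b)) :=
    cos_nonneg_of_mem_Icc ⟨by have : 0 ≤ π / (4 * b) := by positivity
                              linarith [pi_pos], hle⟩
  refine abs_le_of_sq_le_sq ?_ hnn
  have h := cos_odd_mul_pi_div_le b hb a
  have h1 : (2 * a + 1) * (π / (2 * b)) = 2 * ((2 * a + 1) * (π / (4 * b))) := by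
    field_simp; ring
  have h2 : π / (2 * b) = 2 * (π / (4 * b)) := by field_simp; ring
  rw [h1, h2, cos_two_mul, cos_two_mul] at h
  linarith

/-- Every phase is, up to a multiple of `π / 2`, within `gcd(4j, n)π / (4n)` of some
`-2πjk / n`. -/
theorem exists_abs_sub_int_mul_pi_div_two_le (n j : ℕ) (hn : 0 < n) (φ : ℝ) :
    ∃ (k : Fin n) (l : ℤ), |2 * π * j * ((k : ℕ) : ℝ) / n + φ - l * (π / 2)| ≤
      Nat.gcd (4 * j) n * π / (4 * n) := by
  have hG : 0 < Nat.gcd (4 * j) n := Nat.gcd_pos_of_pos_right _ hn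
  have hbez := Nat.gcd_eq_gcd_ab (4 * j) n
  set G := Nat.gcd (4 * j) n
  set u := Nat.gcdA (4 * j) n
  set v := Nat.gcdB (4 * j) n
  have hn' : (0 : ℝ) < n := by positivity
  have hnz : (0 : ℤ) < n := by positivity
  set D : ℝ := G * π / (4 * n) with hD
  have hD0 : 0 < D := by positivity
  set t := round (φ / (2 * D))
  have hround : |φ - 2 * D * t| ≤ D := by
    have h := abs_sub_round (φ / (2 * D))
    have h2 : φ - 2 * D * t = 2 * D * (φ / (2 * D) - t) := by field_simp
    rw [h2, abs_mul, abs_of_pos (by positivity)]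
    nlinarith
  have hk0 : 0 ≤ (-t * u) % n := Int.emod_nonneg _ hnz.ne'
  have hk1 : (-t * u) % n < n := Int.emod_lt_of_pos _ hnz
  have hdiv := Int.emod_add_mul_ediv (-t * u) n
  obtain ⟨k, hk⟩ := Int.eq_ofNat_of_zero_le hk0
  set q := (-t * u) / (n : ℤ)
  refine ⟨⟨k, by omega⟩, t * v - 4 * j * q, ?_⟩
  convert hround using 2
  have hint : 4 * (j : ℤ) * k - (t * v - 4 * j * q) * n = - t * G := by
    rw [hk] at hdiv
    rw [hbez]
    push_cast
    linear_combination 4 * (j : ℤ) * hdiv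
  have hreal : 4 * (j : ℝ) * k - ((t * v - 4 * j * q : ℤ) : ℝ) * n = - t * G := by
    exact_mod_cast hint
  rw [hD]
  field_simp
  linear_combination 4 * π * hreal

theorem cos_le_max_norm (n j : ℕ) (hn : 0 < n) (φ : ℝ) :
    √(2 / n) * cos (Nat.gcd (4 * j) n * π / (4 * n)) ≤ max ‖wvec n j φ‖ ‖wtvec n j φ‖ := by
  obtain ⟨k, l, hkl⟩ := exists_abs_sub_int_mul_pi_div_two_le n j hn φ
  have hn' : (0 : ℝ) < n := by positivity
  have hGle : (Nat.gcd (4 * j) n : ℝ) ≤ n := by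
    exact_mod_cast Nat.le_of_dvd hn (Nat.gcd_dvd_right _ _)
  have hDle : Nat.gcd (4 * j) n * π / (4 * n) ≤ π := by
    rw [div_le_iff₀ (by positivity)]
    nlinarith [pi_pos]
  set x := 2 * π * j * ((k : ℕ) : ℝ) / n + φ with hx
  calc √(2 / n) * cos (Nat.gcd (4 * j) n * π / (4 * n))
      ≤ √(2 / n) * max |sin x| |cos x| := by
        gcongr
        refine le_trans ?_ (abs_cos_sub_int_mul_pi_div_two_le x l)
        refine le_trans ?_ (le_abs_self _)
        rw [← cos_abs (x - _)]
        exact cos_le_cos_of_nonneg_of_le_pi (abs_nonneg _) hDle hkl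
    _ = max |wvec n j φ k| |wtvec n j φ k| := by
        rw [mul_max_of_nonneg _ _ (sqrt_nonneg _), wvec, wtvec, ← hx, abs_mul, abs_mul,
          abs_of_nonneg (sqrt_nonneg _)]
    _ ≤ max ‖wvec n j φ‖ ‖wtvec n j φ‖ :=
        max_le_max (norm_le_pi_norm (wvec n j φ) k) (norm_le_pi_norm (wtvec n j φ) k)

theorem max_norm_le_cos (n j : ℕ) (hn : 0 < n) :
    max ‖wvec n j (Nat.gcd (4 * j) n * π / (4 * n))‖
        ‖wtvec n j (Nat.gcd (4 * j) n * π / (4 * n))‖ ≤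
      √(2 / n) * cos (Nat.gcd (4 * j) n * π / (4 * n)) := by
  have hG : 0 < Nat.gcd (4 * j) n := Nat.gcd_pos_of_pos_right _ hn
  obtain ⟨c, hc⟩ := Nat.gcd_dvd_left (4 * j) n
  obtain ⟨b, hb⟩ := Nat.gcd_dvd_right (4 * j) n
  set G := Nat.gcd (4 * j) n
  have hb0 : 0 < b := Nat.pos_of_ne_zero (by rintro rfl; omega)
  have hnb : (n : ℝ) = G * b := by exact_mod_cast hb
  have hjc : 4 * (j : ℝ) = G * c := by exact_mod_cast hc
  have hG' : (0 : ℝ) < G := by positivity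
  have hb' : (0 : ℝ) < b := by positivity
  have hD : G * π / (4 * n) = π / (4 * b) := by rw [hnb]; field_simp
  have hangle (k : ℕ) : 2 * π * j * (k : ℝ) / n + π / (4 * b) =
      (2 * ((c * k : ℤ) : ℝ) + 1) * (π / (4 * b)) := by
    rw [hnb]
    push_cast
    field_simp
    linear_combination 2 * (k : ℝ) * hjc
  rw [hD]
  have hnn : 0 ≤ √(2 / n) * cos (π / (4 * b)) :=
    mul_nonneg (sqrt_nonneg _) ((abs_nonneg _).trans (abs_cos_odd_mul_pi_div_le b hb0 0))
  refine max_le ?_ ?_ <;> refine (pi_norm_le_iff_of_nonneg hnn).2 fun k => ?_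
  · rw [wvec, norm_eq_abs, abs_mul, abs_of_nonneg (sqrt_nonneg _), hangle, ← cos_sub_pi_div_two]
    gcongr
    have hshift : (2 * ((c * k : ℤ) : ℝ) + 1) * (π / (4 * b)) - π / 2 =
        (2 * ((c * k - b : ℤ) : ℝ) + 1) * (π / (4 * b)) := by
      push_cast
      field_simp
      ring
    rw [hshift]
    exact abs_cos_odd_mul_pi_div_le b hb0 (c * k - b)
  · rw [wtvec, norm_eq_abs, abs_mul, abs_of_nonneg (sqrt_nonneg _), hangle]
    gcongr
    exact abs_cos_odd_mul_pi_div_le b hb0 (c * k)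

theorem stmt9 (n j : ℕ) (hn : 3 ≤ n) (hj1 : 1 ≤ j) (hj2 : j ≤ (n - 1) / 2) :
    IsLeast {x : ℝ | ∃ φ : ℝ, x = max ‖wvec n j φ‖ ‖wtvec n j φ‖}
      (Real.sqrt (2 / n) * Real.cos (DeltaStar (n / Nat.gcd j n))) := by
  have hn0 : 0 < n := by omega
  rw [deltaStar_div_gcd n j hn0]
  refine ⟨⟨_, le_antisymm (cos_le_max_norm n j hn0 _) (max_norm_le_cos n j hn0)⟩, ?_⟩
  rintro x ⟨φ, rfl⟩
  exact cos_le_max_norm n j hn0 φ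
end

section
/- Let n ≥ 3 and 1 ≤ j ≤ ⌊(n−1)/2⌋, and set n' := n/gcd(j,n). Then the minimum over real phases φ of sup_{0≤k,l≤n−1} n·max{ |w_j^{(φ)}(k)·w_j^{(φ)}(l)| , |w̃_j^{(φ)}(k)·w̃_j^{(φ)}(l)| } equals 2·cos²(Δ*(n')). -/
open Real

/-- Writing `4j/n` in lowest terms as `a/M`, one has `Δ*(n / gcd(j, n)) = π/(4M)`. -/
theorem exists_coprime_and_DeltaStar_eq (n j : ℕ) (hn : 0 < n) :
    ∃ a M : ℕ, 0 < M ∧ M ≤ n ∧ Nat.Coprime a M ∧ 4 * j * M = a * n ∧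
      DeltaStar (n / Nat.gcd j n) = π / (4 * M) := by
  obtain ⟨d, j', m, hd, hco, rfl, rfl⟩ := Nat.exists_coprime' (m := j) (n := n)
    (Nat.gcd_pos_of_pos_right _ hn)
  have hm : 0 < m := Nat.pos_of_mul_pos_right hn
  have hgcd : Nat.gcd (j' * d) (m * d) = d := by
    rw [Nat.gcd_mul_right, hco.gcd_eq_one, one_mul]
  rw [hgcd, Nat.mul_div_cancel _ hd]
  obtain ⟨g, e, M, hg, heM, h4, rfl⟩ := Nat.exists_coprime' (m := 4) (n := m)
    (Nat.gcd_pos_of_pos_right _ hm)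
  have hM : 0 < M := Nat.pos_of_mul_pos_right hm
  refine ⟨e * j', M, hM, ?_, ?_, ?_, ?_⟩
  · nlinarith [Nat.mul_le_mul_left M (Nat.mul_pos hg hd)]
  · exact Nat.Coprime.mul_left heM (hco.coprime_dvd_right (Dvd.intro _ rfl))
  · rw [h4]; ring
  · have hM' : (M : ℝ) ≠ 0 := by positivity
    have hg4 : g ∣ 4 := ⟨e, by rw [h4, mul_comm]⟩
    have hgle : g ≤ 4 := Nat.le_of_dvd (by norm_num) hg4
    unfold DeltaStar
    interval_cases g
    · have he : e = 4 := by omega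
      subst he
      have h2 : M % 2 = 1 := Nat.odd_iff.mp
        (Nat.coprime_two_left.mp (heM.coprime_dvd_left (by norm_num)))
      rw [if_neg (by omega), if_neg (by omega)]
      simp
    · have he : e = 2 := by omega
      subst he
      have h2 : M % 2 = 1 := Nat.odd_iff.mp (Nat.coprime_two_left.mp heM)
      rw [if_neg (by omega), if_pos (by omega)]
      push_cast
      congr 1; ring
    · omega
    · rw [if_pos (by omega)]
      push_cast
      congr 1; ring

/-- Among the odd multiples of `π/(4M)`, the first maximizes `|cos|`. -/
theorem abs_cos_odd_mul_le (M N : ℕ) (hM : 0 < M) :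
    |cos ((2 * N + 1) * (π / (4 * M)))| ≤ cos (π / (4 * M)) := by
  have hM' : (0 : ℝ) < M := by exact_mod_cast hM
  have hM1 : (1 : ℝ) ≤ M := by exact_mod_cast hM
  set D := π / (4 * M) with hD
  have hDpi : 4 * M * D = π := by rw [hD]; field_simp
  have hDpos : 0 < D := by positivity
  set r := N % (2 * M)
  set q := N / (2 * M)
  have hN : (N : ℝ) = 2 * M * q + r := by exact_mod_cast (Nat.div_add_mod N (2 * M)).symm
  have hr : (r : ℝ) + 1 ≤ 2 * M := by exact_mod_cast Nat.mod_lt N (by omega : 0 < 2 * M)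
  have hr0 : (0 : ℝ) ≤ r := Nat.cast_nonneg r
  have hθ : (2 * N + 1) * D = (2 * r + 1) * D + q * π := by rw [hN, ← hDpi]; ring
  have habs : |cos ((2 * N + 1) * D)| = |cos ((2 * r + 1) * D)| := by
    rw [hθ, cos_add_nat_mul_pi, abs_mul, abs_pow]; simp
  rw [habs, abs_le]
  constructor
  · rw [neg_le, ← cos_pi_sub]
    apply cos_le_cos_of_nonneg_of_le_pi hDpos.le <;> nlinarith
  · apply cos_le_cos_of_nonneg_of_le_pi hDpos.le <;> nlinarith

/-- Every phase brings some point `φ + k·aπ/(2M)` within `π/(4M)` of a multiple of `π/2`. -/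
theorem exists_cos_sq_le_max (a M : ℕ) (hM : 0 < M) (ha : Nat.Coprime a M) (φ : ℝ) :
    ∃ k : ℕ, k < M ∧ cos (π / (4 * M)) ^ 2 ≤
      max (sin (k * (a * (π / (2 * M))) + φ) ^ 2) (cos (k * (a * (π / (2 * M))) + φ) ^ 2) := by
  have hM' : (0 : ℝ) < M := by exact_mod_cast hM
  have hM1 : (1 : ℝ) ≤ M := by exact_mod_cast hM
  set D := π / (4 * M) with hD
  have hD2 : π / (2 * M) = 2 * D := by rw [hD]; field_simp; norm_num
  have hDpi : 4 * M * D = π := by rw [hD]; field_simp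
  have hDpos : 0 < D := by positivity
  obtain ⟨N, hN⟩ : ∃ N : ℤ, |2 * D * N + φ| ≤ D := by
    refine ⟨round (-φ / (2 * D)), ?_⟩
    have h := abs_sub_round (-φ / (2 * D))
    have e : 2 * D * round (-φ / (2 * D)) + φ
        = -(2 * D) * (-φ / (2 * D) - round (-φ / (2 * D))) := by field_simp; ring
    rw [e, abs_mul, abs_neg, abs_of_pos (by positivity)]
    nlinarith
  obtain ⟨k, hkM, s, hs⟩ : ∃ k : ℕ, k < M ∧ ∃ s : ℤ, (a : ℤ) * k = N + M * s := by
    have hM0 : (M : ℤ) ≠ 0 := by exact_mod_cast hM.ne'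
    have hbez : (1 : ℤ) = a * Nat.gcdA a M + M * Nat.gcdB a M := by
      rw [← Nat.gcd_eq_gcd_ab, ha.gcd_eq_one]; rfl
    set x := N * Nat.gcdA a M
    have h0 := Int.emod_nonneg x hM0
    have h1 := Int.emod_lt_of_pos x (by exact_mod_cast hM : (0 : ℤ) < M)
    have h2 := Int.emod_add_mul_ediv x M
    lift x % M to ℕ using h0 with k
    refine ⟨k, by exact_mod_cast h1, -(N * Nat.gcdB a M) - a * (x / M), ?_⟩
    have hx : x = N * Nat.gcdA a M := rfl
    linear_combination (a : ℤ) * h2 + (a : ℤ) * hx - N * hbez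
  refine ⟨k, hkM, ?_⟩
  have hs' : (a : ℝ) * k = N + M * s := by exact_mod_cast hs
  set θ := (k : ℝ) * (a * (π / (2 * M))) + φ with hθ
  set ψ := 2 * D * N + φ
  have h2θ : 2 * θ = 2 * ψ + s * π := by
    rw [hθ, hD2]
    linear_combination 4 * D * hs' + s * hDpi
  have hψ : cos D ^ 2 ≤ cos ψ ^ 2 := by
    have h := cos_le_cos_of_nonneg_of_le_pi (abs_nonneg ψ) (by nlinarith) hN
    rw [cos_abs] at h
    exact pow_le_pow_left₀ (cos_nonneg_of_mem_Icc ⟨by nlinarith, by nlinarith⟩) h 2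
  have hc := congrArg cos h2θ
  rw [cos_add_int_mul_pi, cos_two_mul, cos_two_mul] at hc
  have hsc := sin_sq_add_cos_sq θ
  rcases Int.even_or_odd s with he | ho
  · rw [he.neg_one_zpow] at hc
    exact le_max_of_le_right (by linarith)
  · rw [ho.neg_one_zpow] at hc
    exact le_max_of_le_left (by linarith)

theorem mul_max_abs_wvec_wtvec (n j : ℕ) (hn : 0 < n) (φ : ℝ) (k l : Fin n) :
    (n : ℝ) * max |wvec n j φ k * wvec n j φ l| |wtvec n j φ k * wtvec n j φ l| =
      2 * max
        |sin (2 * π * j * (k : ℕ) / n + φ) * sin (2 * π * j * (l : ℕ) / n + φ)|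
        |cos (2 * π * j * (k : ℕ) / n + φ) * cos (2 * π * j * (l : ℕ) / n + φ)| := by
  have hn' : (0 : ℝ) < n := by exact_mod_cast hn
  have hsq : √(2 / (n : ℝ)) * √(2 / (n : ℝ)) = 2 / n := mul_self_sqrt (by positivity)
  have key (x y : ℝ) : |√(2 / (n : ℝ)) * x * (√(2 / (n : ℝ)) * y)| = 2 / n * |x * y| := by
    rw [mul_mul_mul_comm, hsq, abs_mul, abs_of_pos (by positivity)]
  unfold wvec wtvec
  rw [key, key, ← mul_max_of_nonneg _ _ (by positivity), ← mul_assoc]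
  congr 1
  field_simp

theorem stmt10 (n j : ℕ) (hn : 3 ≤ n) (hj1 : 1 ≤ j) (hj2 : j ≤ (n - 1) / 2) :
    IsLeast {x : ℝ | ∃ φ : ℝ, x = ⨆ k : Fin n, ⨆ l : Fin n,
        (n : ℝ) * max |wvec n j φ k * wvec n j φ l| |wtvec n j φ k * wtvec n j φ l|}
      (2 * Real.cos (DeltaStar (n / Nat.gcd j n)) ^ 2) := by
  have hn0 : 0 < n := by omega
  have : Nonempty (Fin n) := ⟨⟨0, hn0⟩⟩
  obtain ⟨a, M, hM, hMn, hco, hjM, hΔ⟩ := exists_coprime_and_DeltaStar_eq n j hn0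
  have hn' : (0 : ℝ) < n := by exact_mod_cast hn0
  have hM' : (0 : ℝ) < M := by exact_mod_cast hM
  have hjM' : 4 * (j : ℝ) * M = a * n := by exact_mod_cast hjM
  have hangle (k : ℕ) : 2 * π * j * k / n = k * (a * (π / (2 * M))) := by
    field_simp
    linear_combination (k : ℝ) * hjM'
  rw [hΔ]
  simp only [mul_max_abs_wvec_wtvec n j hn0, hangle]
  have lower (φ : ℝ) : 2 * cos (π / (4 * M)) ^ 2 ≤ ⨆ k : Fin n, ⨆ l : Fin n, 2 * max
      |sin ((k : ℕ) * (a * (π / (2 * M))) + φ) * sin ((l : ℕ) * (a * (π / (2 * M))) + φ)|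
      |cos ((k : ℕ) * (a * (π / (2 * M))) + φ) * cos ((l : ℕ) * (a * (π / (2 * M))) + φ)| := by
    obtain ⟨k, hk, h⟩ := exists_cos_sq_le_max a M hM hco φ
    refine le_ciSup_of_le (Set.finite_range _).bddAbove ⟨k, hk.trans_le hMn⟩ <|
      le_ciSup_of_le (Set.finite_range _).bddAbove ⟨k, hk.trans_le hMn⟩ ?_
    simpa only [abs_mul_self, ← pow_two, abs_sq, mul_le_mul_iff_right₀ (zero_lt_two' ℝ)] using h
  refine ⟨⟨π / (4 * M), (lower _).antisymm ?_⟩, ?_⟩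
  · have hcos (k : ℕ) :
        |cos (k * (a * (π / (2 * M))) + π / (4 * M))| ≤ cos (π / (4 * M)) := by
      convert abs_cos_odd_mul_le M (k * a) hM using 3
      push_cast
      field_simp
      ring
    have hsin (k : ℕ) :
        |sin (k * (a * (π / (2 * M))) + π / (4 * M))| ≤ cos (π / (4 * M)) := by
      rw [← abs_neg, ← cos_add_pi_div_two]
      convert abs_cos_odd_mul_le M (k * a + M) hM using 3
      push_cast
      field_simp
      ring
    refine ciSup_le fun k => ciSup_le fun l => ?_
    rw [pow_two]
    refine mul_le_mul_of_nonneg_left (max_le ?_ ?_) zero_le_two <;> rw [abs_mul]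
    · exact mul_le_mul (hsin k) (hsin l) (abs_nonneg _) ((abs_nonneg _).trans (hsin k))
    · exact mul_le_mul (hcos k) (hcos l) (abs_nonneg _) ((abs_nonneg _).trans (hcos k))
  · rintro x ⟨φ, rfl⟩
    exact lower φ
end

section
/- Let n ≥ 3, 1 ≤ j ≤ ⌊(n−1)/2⌋, and set n' := n/gcd(j,n). For every orthonormal pair (u, v) of vectors in ℝⁿ spanning the two-dimensional space E_j := span{u_j, v_j}, where u_j(k) = √(2/n)·cos(2πjk/n) and v_j(k) = √(2/n)·sin(2πjk/n), one has max{‖u‖_∞, ‖v‖_∞} ≥ √(2/n)·cos(Δ*(n')). -/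
open Real

/-- `u_j(k) = √(2/n)·cos(2πjk/n)`. -/
noncomputable def uvec (n j : ℕ) : Fin n → ℝ :=
  fun k => Real.sqrt (2 / n) * Real.cos (2 * Real.pi * (j : ℝ) * ((k : ℕ) : ℝ) / (n : ℝ))

/-- `v_j(k) = √(2/n)·sin(2πjk/n)`. -/
noncomputable def vvec (n j : ℕ) : Fin n → ℝ :=
  fun k => Real.sqrt (2 / n) * Real.sin (2 * Real.pi * (j : ℝ) * ((k : ℕ) : ℝ) / (n : ℝ))

theorem DeltaStar_eq_gcd (m : ℕ) (hm : 0 < m) :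
    DeltaStar m = Real.pi * (Nat.gcd 4 m : ℕ) / (4 * m) := by
  have hm' : (m : ℝ) ≠ 0 := by positivity
  have hg : Nat.gcd 4 m = Nat.gcd (m % 4) 4 := Nat.gcd_rec 4 m
  have hlt : m % 4 < 4 := Nat.mod_lt _ (by norm_num)
  rw [hg]
  unfold DeltaStar
  interval_cases m % 4 <;> norm_num <;> field_simp
  norm_num

theorem DeltaStar_div_gcd (n j : ℕ) (hn : 0 < n) :
    DeltaStar (n / Nat.gcd j n) = Real.pi * (Nat.gcd (4 * j) n : ℕ) / (4 * n) := by
  obtain ⟨g, j', n', hg, hcop, rfl, rfl⟩ := Nat.exists_coprime' (Nat.gcd_pos_of_pos_right j hn)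
  have hn' : 0 < n' := Nat.pos_of_mul_pos_right hn
  have hg' : (g : ℝ) ≠ 0 := by positivity
  have hn'' : (n' : ℝ) ≠ 0 := by positivity
  rw [Nat.gcd_mul_right, hcop.gcd_eq_one, one_mul, Nat.mul_div_cancel _ hg,
    DeltaStar_eq_gcd n' hn', ← mul_assoc, Nat.gcd_mul_right,
    Nat.Coprime.gcd_mul_right_cancel 4 hcop]
  push_cast
  field_simp

/-- The angles `2πjk/n + yπ/2` come within `Δ*(n')` of every real number. -/
theorem exists_angle_near (n j : ℕ) (hn : 0 < n) (θ : ℝ) :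
    ∃ k : Fin n, ∃ y : ℤ,
      |2 * Real.pi * (j : ℝ) * ((k : ℕ) : ℝ) / (n : ℝ) - θ - y * (Real.pi / 2)|
        ≤ DeltaStar (n / Nat.gcd j n) := by
  rw [DeltaStar_div_gcd n j hn]
  set d := Nat.gcd (4 * j) n with hd
  have hdpos : 0 < d := Nat.gcd_pos_of_pos_right _ hn
  have hnR : (0 : ℝ) < n := by positivity
  have hdR : (0 : ℝ) < d := by positivity
  have hpi := Real.pi_pos
  set q : ℤ := round (θ * (2 * n) / (Real.pi * d)) with hq
  have hround := abs_sub_round (θ * (2 * n) / (Real.pi * d))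
  rw [← hq] at hround
  have hbez : (d : ℤ) = (4 * j : ℕ) * Nat.gcdA (4 * j) n + n * Nat.gcdB (4 * j) n :=
    Nat.gcd_eq_gcd_ab _ _
  set x := Nat.gcdA (4 * j) n
  set w := Nat.gcdB (4 * j) n
  have hnZ : (0 : ℤ) < n := by exact_mod_cast hn
  have hmod0 := Int.emod_nonneg (q * x) hnZ.ne'
  have hmodlt := Int.emod_lt_of_pos (q * x) hnZ
  have hdm := Int.emod_add_mul_ediv (q * x) n
  set r := (q * x) % n
  set s := (q * x) / n
  obtain ⟨k, hk⟩ := Int.eq_ofNat_of_zero_le hmod0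
  refine ⟨⟨k, by omega⟩, -(q * w + 4 * j * s), ?_⟩
  have hkey : (4 * j * k + n * (q * w + 4 * j * s) : ℤ) = q * d := by
    rw [hbez]
    push_cast
    rw [hk] at hdm
    linear_combination (4 * j : ℤ) * hdm
  have hkeyR : (4 * j * k + n * (q * w + 4 * j * s) : ℝ) = q * d := by exact_mod_cast hkey
  have heq : 2 * Real.pi * (j : ℝ) * (k : ℝ) / (n : ℝ) - θ
      - ((-(q * w + 4 * j * s) : ℤ) : ℝ) * (Real.pi / 2)
      = -(Real.pi * d / (2 * n)) * (θ * (2 * n) / (Real.pi * d) - q) := by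
    push_cast
    field_simp
    linear_combination Real.pi * hkeyR
  rw [heq, abs_mul, abs_neg, abs_of_pos (by positivity)]
  calc Real.pi * d / (2 * n) * |θ * (2 * n) / (Real.pi * d) - q|
      ≤ Real.pi * d / (2 * n) * (1 / 2) := by gcongr
    _ = Real.pi * d / (4 * n) := by ring

theorem DeltaStar_le_pi_div_two (m : ℕ) (hm : 0 < m) : DeltaStar m ≤ Real.pi / 2 := by
  have hmR : (0 : ℝ) < m := by positivity
  have hle : ((Nat.gcd 4 m : ℕ) : ℝ) ≤ m := by exact_mod_cast Nat.gcd_le_right 4 hm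
  have hpi := Real.pi_pos
  rw [DeltaStar_eq_gcd m hm, div_le_div_iff₀ (by positivity) (by positivity)]
  nlinarith [mul_le_mul_of_nonneg_left hle hpi.le, mul_pos hpi hmR]

theorem abs_cos_or_abs_sin_eq (x : ℝ) (y : ℤ) :
    |Real.cos x| = |Real.cos (x - y * (Real.pi / 2))| ∨
      |Real.sin x| = |Real.cos (x - y * (Real.pi / 2))| := by
  obtain ⟨t, rfl | rfl⟩ := Int.even_or_odd' y
  · left
    have h : x - ((2 * t : ℤ) : ℝ) * (Real.pi / 2) = x - t * Real.pi := by push_cast; ring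
    rw [h, Real.cos_sub_int_mul_pi, abs_mul, abs_zpow, abs_neg, abs_one, one_zpow, one_mul]
  · right
    have h : x - ((2 * t + 1 : ℤ) : ℝ) * (Real.pi / 2) = (x - t * Real.pi) - Real.pi / 2 := by
      push_cast; ring
    rw [h, Real.cos_sub_pi_div_two, Real.sin_sub_int_mul_pi, abs_mul, abs_zpow, abs_neg, abs_one,
      one_zpow, one_mul]

theorem sum_cexp_double_angle (n j : ℕ) (hj1 : 0 < j) (hj2 : 2 * j < n) :
    ∑ k : Fin n, Complex.exp
      (((2 * (2 * Real.pi * (j : ℝ) * ((k : ℕ) : ℝ) / (n : ℝ)) : ℝ) : ℂ) * Complex.I) = 0 := by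
  have hn : n ≠ 0 := by omega
  have hnC : (n : ℂ) ≠ 0 := by exact_mod_cast hn
  have hprim := Complex.isPrimitiveRoot_exp n hn
  set ζ := Complex.exp (2 * Real.pi * Complex.I / n) with hζ
  have hne : ζ ^ (2 * j) ≠ 1 := hprim.pow_ne_one_of_pos_of_lt (by omega) hj2
  have hterm : ∀ k : Fin n, Complex.exp
      (((2 * (2 * Real.pi * (j : ℝ) * ((k : ℕ) : ℝ) / (n : ℝ)) : ℝ) : ℂ) * Complex.I)
      = (ζ ^ (2 * j)) ^ (k : ℕ) := by
    intro k
    rw [hζ, ← Complex.exp_nat_mul, ← Complex.exp_nat_mul]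
    congr 1
    push_cast
    field_simp
  rw [Finset.sum_congr rfl fun k _ => hterm k,
    Fin.sum_univ_eq_sum_range (fun k => (ζ ^ (2 * j)) ^ k),
    geom_sum_eq hne, ← pow_mul, mul_comm (2 * j) n, pow_mul, hprim.pow_eq_one, one_pow, sub_self,
    zero_div]

theorem sum_cos_double_angle (n j : ℕ) (hj1 : 0 < j) (hj2 : 2 * j < n) :
    ∑ k : Fin n, Real.cos (2 * (2 * Real.pi * (j : ℝ) * ((k : ℕ) : ℝ) / (n : ℝ))) = 0 := by
  have h := congrArg Complex.re (sum_cexp_double_angle n j hj1 hj2)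
  rw [Complex.re_sum] at h
  simpa only [Complex.exp_ofReal_mul_I_re, Complex.zero_re] using h

theorem sum_sin_double_angle (n j : ℕ) (hj1 : 0 < j) (hj2 : 2 * j < n) :
    ∑ k : Fin n, Real.sin (2 * (2 * Real.pi * (j : ℝ) * ((k : ℕ) : ℝ) / (n : ℝ))) = 0 := by
  have h := congrArg Complex.im (sum_cexp_double_angle n j hj1 hj2)
  rw [Complex.im_sum] at h
  simpa only [Complex.exp_ofReal_mul_I_im, Complex.zero_im] using h

theorem sum_uvec_mul_uvec (n j : ℕ) (hj1 : 0 < j) (hj2 : 2 * j < n) :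
    ∑ k, uvec n j k * uvec n j k = 1 := by
  have hn : (n : ℝ) ≠ 0 := by norm_cast; omega
  have hs : Real.sqrt (2 / n) * Real.sqrt (2 / n) = 2 / n := Real.mul_self_sqrt (by positivity)
  have hterm : ∀ k : Fin n, uvec n j k * uvec n j k
      = 1 / n + 1 / n * Real.cos (2 * (2 * Real.pi * (j : ℝ) * ((k : ℕ) : ℝ) / (n : ℝ))) := by
    intro k
    rw [uvec, mul_mul_mul_comm, hs, Real.cos_two_mul]
    ring
  rw [Finset.sum_congr rfl fun k _ => hterm k, Finset.sum_add_distrib, ← Finset.mul_sum,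
    sum_cos_double_angle n j hj1 hj2]
  simp [hn]

theorem sum_vvec_mul_vvec (n j : ℕ) (hj1 : 0 < j) (hj2 : 2 * j < n) :
    ∑ k, vvec n j k * vvec n j k = 1 := by
  have hn : (n : ℝ) ≠ 0 := by norm_cast; omega
  have hs : Real.sqrt (2 / n) * Real.sqrt (2 / n) = 2 / n := Real.mul_self_sqrt (by positivity)
  have hterm : ∀ k : Fin n, vvec n j k * vvec n j k
      = 1 / n - 1 / n * Real.cos (2 * (2 * Real.pi * (j : ℝ) * ((k : ℕ) : ℝ) / (n : ℝ))) := by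
    intro k
    rw [vvec, mul_mul_mul_comm, hs, Real.cos_two_mul, Real.cos_sq']
    ring
  rw [Finset.sum_congr rfl fun k _ => hterm k, Finset.sum_sub_distrib, ← Finset.mul_sum,
    sum_cos_double_angle n j hj1 hj2]
  simp [hn]

theorem sum_uvec_mul_vvec (n j : ℕ) (hj1 : 0 < j) (hj2 : 2 * j < n) :
    ∑ k, uvec n j k * vvec n j k = 0 := by
  have hs : Real.sqrt (2 / n) * Real.sqrt (2 / n) = 2 / n := Real.mul_self_sqrt (by positivity)
  have hterm : ∀ k : Fin n, uvec n j k * vvec n j k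
      = 1 / n * Real.sin (2 * (2 * Real.pi * (j : ℝ) * ((k : ℕ) : ℝ) / (n : ℝ))) := by
    intro k
    rw [uvec, vvec, mul_mul_mul_comm, hs, Real.sin_two_mul]
    ring
  rw [Finset.sum_congr rfl fun k _ => hterm k, ← Finset.mul_sum,
    sum_sin_double_angle n j hj1 hj2, mul_zero]

/-- The inner product of two vectors of `E_j` in the coordinates given by `u_j, v_j`. -/
theorem sum_comb_mul_comb (n j : ℕ) (hj1 : 0 < j) (hj2 : 2 * j < n) (a b c d : ℝ) :
    ∑ k, (a • uvec n j + b • vvec n j) k * (c • uvec n j + d • vvec n j) k = a * c + b * d := by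
  have hterm : ∀ k, (a • uvec n j + b • vvec n j) k * (c • uvec n j + d • vvec n j) k
      = a * c * (uvec n j k * uvec n j k) + (a * d + b * c) * (uvec n j k * vvec n j k)
        + b * d * (vvec n j k * vvec n j k) := by
    intro k
    simp only [Pi.add_apply, Pi.smul_apply, smul_eq_mul]
    ring
  rw [Finset.sum_congr rfl fun k _ => hterm k, Finset.sum_add_distrib, Finset.sum_add_distrib,
    ← Finset.mul_sum, ← Finset.mul_sum, ← Finset.mul_sum, sum_uvec_mul_uvec n j hj1 hj2,
    sum_uvec_mul_vvec n j hj1 hj2, sum_vvec_mul_vvec n j hj1 hj2]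
  ring

theorem exists_cos_sin_of_sq_add_sq {a b : ℝ} (h : a * a + b * b = 1) :
    ∃ θ : ℝ, a = Real.cos θ ∧ b = Real.sin θ := by
  have hnorm : ‖(⟨a, b⟩ : ℂ)‖ = 1 := by
    rw [Complex.norm_def, Complex.normSq_mk, h, Real.sqrt_one]
  refine ⟨Complex.arg ⟨a, b⟩, ?_, ?_⟩
  · simpa [hnorm] using (Complex.norm_mul_cos_arg ⟨a, b⟩).symm
  · simpa [hnorm] using (Complex.norm_mul_sin_arg ⟨a, b⟩).symm

theorem stmt11 (n j : ℕ) (hn : 3 ≤ n) (hj1 : 1 ≤ j) (hj2 : j ≤ (n - 1) / 2)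
    (u v : Fin n → ℝ)
    (hu : ∑ k, u k * u k = 1) (hv : ∑ k, v k * v k = 1)
    (huv : ∑ k, u k * v k = 0)
    (hspan : Submodule.span ℝ ({u, v} : Set (Fin n → ℝ))
      = Submodule.span ℝ ({uvec n j, vvec n j} : Set (Fin n → ℝ))) :
    Real.sqrt (2 / n) * Real.cos (DeltaStar (n / Nat.gcd j n)) ≤ max ‖u‖ ‖v‖ := by
  have hj3 : 2 * j < n := by omega
  have hu_mem : u ∈ Submodule.span ℝ ({uvec n j, vvec n j} : Set (Fin n → ℝ)) :=
    hspan ▸ Submodule.subset_span (by simp)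
  have hv_mem : v ∈ Submodule.span ℝ ({uvec n j, vvec n j} : Set (Fin n → ℝ)) :=
    hspan ▸ Submodule.subset_span (by simp)
  obtain ⟨a, b, rfl⟩ := Submodule.mem_span_pair.mp hu_mem
  obtain ⟨c, d, rfl⟩ := Submodule.mem_span_pair.mp hv_mem
  rw [sum_comb_mul_comb n j hj1 hj3] at hu hv huv
  obtain ⟨θ, rfl, rfl⟩ := exists_cos_sin_of_sq_add_sq hu
  set t := Real.cos θ * d - Real.sin θ * c
  have hc : c = -t * Real.sin θ := by linear_combination (-c) * hu + Real.cos θ * huv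
  have hd : d = t * Real.cos θ := by linear_combination (-d) * hu + Real.sin θ * huv
  have ht_sq : t ^ 2 = 1 := by
    linear_combination hv - c * hc - d * hd
  have ht_abs : |t| = 1 := by rwa [← sq_eq_sq₀ (abs_nonneg t) zero_le_one, sq_abs, one_pow]
  obtain ⟨k, y, hky⟩ := exists_angle_near n j (by omega) θ
  set α := 2 * Real.pi * (j : ℝ) * ((k : ℕ) : ℝ) / (n : ℝ) with hα
  have hle : DeltaStar (n / Nat.gcd j n) ≤ Real.pi / 2 :=
    DeltaStar_le_pi_div_two _ (Nat.div_pos (Nat.gcd_le_right j (by omega))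
      (Nat.gcd_pos_of_pos_left n hj1))
  have hcos : Real.cos (DeltaStar (n / Nat.gcd j n))
      ≤ |Real.cos (α - θ - y * (Real.pi / 2))| := by
    rw [← Real.cos_abs (α - θ - y * (Real.pi / 2))]
    exact (Real.cos_le_cos_of_nonneg_of_le_pi (abs_nonneg _)
      (by linarith [Real.pi_pos]) hky).trans (le_abs_self _)
  rcases abs_cos_or_abs_sin_eq (α - θ) y with h | h
  · refine le_trans ?_ ((norm_le_pi_norm _ k).trans (le_max_left _ _))
    have hval : (Real.cos θ • uvec n j + Real.sin θ • vvec n j) k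
        = Real.sqrt (2 / n) * Real.cos (α - θ) := by
      simp only [Pi.add_apply, Pi.smul_apply, smul_eq_mul, uvec, vvec, ← hα, Real.cos_sub]
      ring
    rw [hval, Real.norm_eq_abs, abs_mul, abs_of_nonneg (Real.sqrt_nonneg _), h]
    gcongr
  · refine le_trans ?_ ((norm_le_pi_norm _ k).trans (le_max_right _ _))
    have hval : (c • uvec n j + d • vvec n j) k
        = Real.sqrt (2 / n) * (t * Real.sin (α - θ)) := by
      simp only [Pi.add_apply, Pi.smul_apply, smul_eq_mul, uvec, vvec, ← hα, Real.sin_sub]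
      linear_combination (Real.sqrt (2 / n) * Real.cos α) * hc
        + (Real.sqrt (2 / n) * Real.sin α) * hd
    rw [hval, Real.norm_eq_abs, abs_mul, abs_of_nonneg (Real.sqrt_nonneg _), abs_mul, ht_abs,
      one_mul, h]
    gcongr
end

section
/- For every integer n ≥ 3 there exists a real orthogonal n×n matrix Q with first column equal to (1/√n)·𝟏 such that the coherence M(Q) := n·max_{1≤j≤n−1} ‖q_j‖_∞² (q_j the j-th column of Q) equals 2·cos²(π/n) if n ≡ 0 (mod 4), equals 2·cos²(π/(2n)) if n ≡ 2 (mod 4), and equals 2·cos²(π/(4n)) if n is odd. -/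
open Real Matrix

/-- Coherence of an `n×n` real matrix: `M(Q) = n · max_{1≤j≤n−1} ‖q_j‖_∞²`,
where `q_j` is the `j`-th column of `Q` and `‖·‖` is the sup norm on `ℝⁿ`. -/
noncomputable def coherence (n : ℕ) (Q : Matrix (Fin n) (Fin n) ℝ) : ℝ :=
  (n : ℝ) * sSup {x : ℝ | ∃ j : Fin n, (j : ℕ) ≠ 0 ∧ x = ‖(fun k : Fin n => Q k j)‖ ^ 2}

/-- The values of a cosine at `n` equally spaced points winding `a` times around the circle sum to
zero unless `n ∣ a`. -/
theorem sum_cos_equispaced_eq_zero {n : ℕ} (hn : n ≠ 0) {a : ℤ} (ha : ¬ (n : ℤ) ∣ a) (β : ℝ) :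
    ∑ k ∈ Finset.range n, Real.cos (2 * π * a * k / n + β) = 0 := by
  have hn' : (n : ℝ) ≠ 0 := by exact_mod_cast hn
  have hsin : Real.sin (π * a / n) ≠ 0 := by
    intro h
    obtain ⟨m, hm⟩ := Real.sin_eq_zero_iff.1 h
    apply ha
    refine ⟨m, ?_⟩
    have h1 : π * ((n : ℝ) * m) = π * a := by
      field_simp at hm
      linear_combination π * hm
    exact_mod_cast (mul_left_cancel₀ Real.pi_ne_zero h1).symm
  have htel : ∀ k : ℕ, 2 * Real.sin (π * a / n) * Real.cos (2 * π * a * k / n + β) =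
      Real.sin (2 * π * a * (k + 1 : ℕ) / n - π * a / n + β) -
        Real.sin (2 * π * a * k / n - π * a / n + β) := by
    intro k
    have e1 : 2 * π * a * (k + 1 : ℕ) / n - π * a / n + β =
        (2 * π * a * k / n + β) + π * a / n := by
      push_cast
      ring
    have e2 : 2 * π * a * k / n - π * a / n + β = (2 * π * a * k / n + β) - π * a / n := by ring
    rw [e1, e2, Real.sin_add, Real.sin_sub]
    ring
  have hsum : 2 * Real.sin (π * a / n) *
      ∑ k ∈ Finset.range n, Real.cos (2 * π * a * k / n + β) = 0 := by
    rw [Finset.mul_sum, Finset.sum_congr rfl fun k _ => htel k,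
      Finset.sum_range_sub (fun k : ℕ => Real.sin (2 * π * a * k / n - π * a / n + β))]
    have e : 2 * π * a * n / n - π * a / n + β =
        (2 * π * a * (0 : ℕ) / n - π * a / n + β) + a * (2 * π) := by
      field_simp
      push_cast
      ring
    rw [e, Real.sin_add_int_mul_two_pi, sub_self]
  exact (mul_eq_zero.1 hsum).resolve_left (mul_ne_zero two_ne_zero hsin)

theorem sum_cos_equispaced_eq_mul {n : ℕ} (hn : n ≠ 0) {a : ℤ} (ha : (n : ℤ) ∣ a) (β : ℝ) :
    ∑ k ∈ Finset.range n, Real.cos (2 * π * a * k / n + β) = n * Real.cos β := by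
  have hn' : (n : ℝ) ≠ 0 := by exact_mod_cast hn
  obtain ⟨m, rfl⟩ := ha
  have h : ∀ k : ℕ, Real.cos (2 * π * ((n * m : ℤ) : ℝ) * k / n + β) = Real.cos β := by
    intro k
    have e : 2 * π * ((n * m : ℤ) : ℝ) * k / n + β = β + ((m * k : ℤ) : ℝ) * (2 * π) := by
      push_cast
      field_simp
      ring
    rw [e, Real.cos_add_int_mul_two_pi]
  rw [Finset.sum_congr rfl fun k _ => h k]
  simp

/-- Among odd multiples of `π / N` with `N` even, `cos ^ 2` is largest at `π / N`. -/
theorem cos_sq_odd_mul_pi_div_le {N : ℤ} (hN : 0 < N) (hNe : Even N) {a : ℤ} (ha : Odd a) :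
    Real.cos (a * π / N) ^ 2 ≤ Real.cos (π / N) ^ 2 := by
  have hN' : (0 : ℝ) < N := by exact_mod_cast hN
  have hr0 := Int.emod_nonneg a hN.ne'
  have hrN := Int.emod_lt_of_pos a hN
  have hdiv := Int.emod_add_mul_ediv a N
  set r := a % N
  set q := a / N
  have hr1 : 1 ≤ r := by
    by_contra! h
    have h0 : r = 0 := by omega
    rw [h0, zero_add] at hdiv
    rw [← hdiv] at ha
    exact Int.not_odd_iff_even.2 (hNe.mul_right q) ha
  have hr1' : (1 : ℝ) ≤ r := by exact_mod_cast hr1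
  have hrN' : (r : ℝ) + 1 ≤ N := by exact_mod_cast hrN
  have hkey : Real.cos (2 * (r * π / N)) ≤ Real.cos (2 * (π / N)) := by
    have hpi := Real.pi_pos
    have hle : 2 * (π / N) ≤ 2 * (r * π / N) := by
      gcongr
      nlinarith
    by_cases hc : 2 * (r * π / N) ≤ π
    · exact Real.cos_le_cos_of_nonneg_of_le_pi (by positivity) hc hle
    · rw [← Real.cos_two_pi_sub (2 * (r * π / N))]
      refine Real.cos_le_cos_of_nonneg_of_le_pi (by positivity) (by linarith) ?_
      have e : 2 * π - 2 * (r * π / N) = 2 * ((N - r) * π / N) := by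
        field_simp
      rw [e]
      gcongr
      nlinarith
  have hper : Real.cos (2 * (a * π / N)) = Real.cos (2 * (r * π / N)) := by
    rw [← hdiv]
    have e : 2 * (((r + N * q : ℤ) : ℝ) * π / N) = 2 * (r * π / N) + q * (2 * π) := by
      push_cast
      field_simp
    rw [e, Real.cos_add_int_mul_two_pi]
  rw [Real.cos_sq, Real.cos_sq, hper]
  linarith

theorem coherence_eq_of_sq_le {n : ℕ} {Q : Matrix (Fin n) (Fin n) ℝ} {c : ℝ}
    (hle : ∀ k j : Fin n, (j : ℕ) ≠ 0 → Q k j ^ 2 ≤ c)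
    (heq : ∃ k j : Fin n, (j : ℕ) ≠ 0 ∧ Q k j ^ 2 = c) :
    coherence n Q = n * c := by
  obtain ⟨k₀, j₀, hj₀, hc⟩ := heq
  have hc0 : 0 ≤ c := hc ▸ sq_nonneg _
  have hub : ∀ j : Fin n, (j : ℕ) ≠ 0 → ‖(fun k : Fin n => Q k j)‖ ^ 2 ≤ c := by
    intro j hj
    have h : ‖(fun k : Fin n => Q k j)‖ ≤ √c :=
      (pi_norm_le_iff_of_nonneg (Real.sqrt_nonneg c)).2 fun k => Real.abs_le_sqrt (hle k j hj)
    calc ‖(fun k : Fin n => Q k j)‖ ^ 2 ≤ √c ^ 2 := by gcongr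
      _ = c := Real.sq_sqrt hc0
  have hgr : IsGreatest {x : ℝ | ∃ j : Fin n, (j : ℕ) ≠ 0 ∧
      x = ‖(fun k : Fin n => Q k j)‖ ^ 2} c := by
    refine ⟨⟨j₀, hj₀, le_antisymm ?_ (hub j₀ hj₀)⟩, ?_⟩
    · rw [← hc, ← sq_abs, ← Real.norm_eq_abs]
      have := norm_le_pi_norm (fun k : Fin n => Q k j₀) k₀
      gcongr
    · rintro x ⟨j, hj, rfl⟩
      exact hub j hj
  rw [coherence, hgr.csSup_eq]

/-- The real Fourier matrix whose `j`-th column has frequency `j` and phase `φ j`. -/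
noncomputable def phasedFourier (n : ℕ) (φ : ℕ → ℝ) : Matrix (Fin n) (Fin n) ℝ :=
  fun k j => √(2 / n) * Real.cos (2 * π * (j : ℕ) * (k : ℕ) / n + φ j)

theorem phasedFourier_sq (n : ℕ) (φ : ℕ → ℝ) (k j : Fin n) :
    phasedFourier n φ k j ^ 2 =
      2 / n * Real.cos (2 * π * (j : ℕ) * (k : ℕ) / n + φ j) ^ 2 := by
  rw [phasedFourier, mul_pow, Real.sq_sqrt (by positivity)]

theorem phasedFourier_transpose_mul_self {n : ℕ} {φ : ℕ → ℝ}
    (hφ : ∀ j l : ℕ, j < n → l < n → n ∣ j + l → φ j + φ l = π / 2) :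
    (phasedFourier n φ)ᵀ * phasedFourier n φ = 1 := by
  ext j l
  have hn : n ≠ 0 := by have := j.2; omega
  have hn' : (n : ℝ) ≠ 0 := by exact_mod_cast hn
  have hadd : ∑ k ∈ Finset.range n,
      Real.cos (2 * π * ((j + l : ℤ) : ℝ) * k / n + (φ j + φ l)) = 0 := by
    by_cases h : (n : ℤ) ∣ (j + l : ℤ)
    · rw [sum_cos_equispaced_eq_mul hn h, hφ j l j.2 l.2 (by exact_mod_cast h),
        Real.cos_pi_div_two, mul_zero]
    · exact sum_cos_equispaced_eq_zero hn h _
  have hsub : ∑ k ∈ Finset.range n,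
      Real.cos (2 * π * ((j - l : ℤ) : ℝ) * k / n + (φ j - φ l)) = if j = l then (n : ℝ) else 0 := by
    split_ifs with h
    · subst h
      rw [sum_cos_equispaced_eq_mul hn (by simp)]
      simp
    · refine sum_cos_equispaced_eq_zero hn (fun hd => h ?_) _
      have hj := j.2
      have hl := l.2
      have := Int.eq_zero_of_abs_lt_dvd hd (by rw [abs_lt]; omega)
      ext
      omega
  have hterm : ∀ k : ℕ, √(2 / n) * Real.cos (2 * π * (j : ℕ) * k / n + φ j) *
      (√(2 / n) * Real.cos (2 * π * (l : ℕ) * k / n + φ l)) =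
      1 / n * (Real.cos (2 * π * ((j + l : ℤ) : ℝ) * k / n + (φ j + φ l)) +
        Real.cos (2 * π * ((j - l : ℤ) : ℝ) * k / n + (φ j - φ l))) := by
    intro k
    have e1 : 2 * π * ((j + l : ℤ) : ℝ) * k / n + (φ j + φ l) =
        (2 * π * (j : ℕ) * k / n + φ j) + (2 * π * (l : ℕ) * k / n + φ l) := by
      push_cast
      ring
    have e2 : 2 * π * ((j - l : ℤ) : ℝ) * k / n + (φ j - φ l) =
        (2 * π * (j : ℕ) * k / n + φ j) - (2 * π * (l : ℕ) * k / n + φ l) := by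
      push_cast
      ring
    have hs : √(2 / n : ℝ) * √(2 / n) = 2 / n := Real.mul_self_sqrt (by positivity)
    rw [e1, e2, Real.cos_add (2 * π * (j : ℕ) * k / n + φ j), Real.cos_sub, mul_mul_mul_comm, hs]
    ring
  simp only [Matrix.mul_apply, Matrix.transpose_apply, phasedFourier, hterm]
  rw [Fin.sum_univ_eq_sum_range (fun k : ℕ =>
      1 / (n : ℝ) * (Real.cos (2 * π * ((j + l : ℤ) : ℝ) * k / n + (φ j + φ l)) +
        Real.cos (2 * π * ((j - l : ℤ) : ℝ) * k / n + (φ j - φ l)))) n,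
    ← Finset.mul_sum, Finset.sum_add_distrib, hadd, hsub, Matrix.one_apply]
  split_ifs <;> simp [hn']

theorem phasedFourier_col_zero {n : ℕ} {φ : ℕ → ℝ} (hφ : φ 0 = π / 4) (k j : Fin n)
    (hj : (j : ℕ) = 0) : phasedFourier n φ k j = 1 / √n := by
  rw [phasedFourier, hj, hφ]
  have h2 : √2 * √2 = (2 : ℝ) := Real.mul_self_sqrt (by norm_num)
  simp only [Nat.cast_zero, mul_zero, zero_mul, zero_div, zero_add, Real.cos_pi_div_four,
    Real.sqrt_div zero_le_two]
  rw [div_mul_div_comm, h2, mul_comm, ← div_div, div_self two_ne_zero]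

theorem exists_orthogonal_coherence_eq {n : ℕ} (hn : n ≠ 0) {φ : ℕ → ℝ} {C : ℝ}
    (hφ : ∀ j l : ℕ, j < n → l < n → n ∣ j + l → φ j + φ l = π / 2)
    (hle : ∀ k j : ℕ, j ≠ 0 → Real.cos (2 * π * j * k / n + φ j) ^ 2 ≤ C)
    (heq : ∃ k j : ℕ, k < n ∧ j < n ∧ j ≠ 0 ∧ Real.cos (2 * π * j * k / n + φ j) ^ 2 = C) :
    ∃ Q : Matrix (Fin n) (Fin n) ℝ, Qᵀ * Q = 1 ∧
      (∀ k j : Fin n, (j : ℕ) = 0 → Q k j = 1 / Real.sqrt n) ∧ coherence n Q = 2 * C := by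
  have hn' : (n : ℝ) ≠ 0 := by exact_mod_cast hn
  have hφ0 : φ 0 = π / 4 := by
    have := hφ 0 0 (by omega) (by omega) (by simp)
    linarith
  refine ⟨phasedFourier n φ, phasedFourier_transpose_mul_self hφ, phasedFourier_col_zero hφ0, ?_⟩
  rw [coherence_eq_of_sq_le (c := 2 / n * C)]
  · field_simp
  · intro k j hj
    rw [phasedFourier_sq]
    have := hle k j hj
    gcongr
  · obtain ⟨k, j, hk, hj, hj0, h⟩ := heq
    exact ⟨⟨k, hk⟩, ⟨j, hj⟩, hj0, by rw [phasedFourier_sq, h]⟩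

/-- The sharp phase for `4 ∣ n`: `π / n` on low frequencies, reflected on high frequencies. -/
noncomputable def splitPhase (n j : ℕ) : ℝ :=
  if j = 0 ∨ 2 * j = n then π / 4 else if 2 * j < n then π / n else π / 2 - π / n

theorem splitPhase_add {n j l : ℕ} (hj : j < n) (hl : l < n) (h : n ∣ j + l) :
    splitPhase n j + splitPhase n l = π / 2 := by
  obtain ⟨c, hc⟩ := h
  have hc2 : c < 2 := by
    by_contra! h2
    have := Nat.mul_le_mul_left n h2
    omega
  unfold splitPhase
  interval_cases c <;> split_ifs <;> first | omega | ring

theorem cos_sq_eq_of_eq_int_mul_pi_add {x y : ℝ} {m : ℤ} (h : x = m * π + y) :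
    Real.cos x ^ 2 = Real.cos y ^ 2 := by
  have e : 2 * x = 2 * y + m * (2 * π) := by rw [h]; ring
  rw [Real.cos_sq, Real.cos_sq y, e, Real.cos_add_int_mul_two_pi]

theorem exists_coherence_eq_of_four_dvd {n : ℕ} (hn : 3 ≤ n) (h4 : n % 4 = 0) :
    ∃ Q : Matrix (Fin n) (Fin n) ℝ, Qᵀ * Q = 1 ∧
      (∀ k j : Fin n, (j : ℕ) = 0 → Q k j = 1 / Real.sqrt n) ∧
      coherence n Q = 2 * Real.cos (π / n) ^ 2 := by
  have hbound : ∀ a : ℤ, Odd a → Real.cos (a * π / n) ^ 2 ≤ Real.cos (π / n) ^ 2 := fun a ha => by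
    exact_mod_cast cos_sq_odd_mul_pi_div_le (N := n) (by omega) (by rw [Int.even_iff]; omega) ha
  obtain ⟨m, rfl⟩ : ∃ m, n = 4 * m := ⟨n / 4, by omega⟩
  refine exists_orthogonal_coherence_eq (φ := splitPhase (4 * m)) (by omega)
    (fun j l => splitPhase_add) ?_ ⟨0, 1, by omega, by omega, by omega, ?_⟩
  · intro k j hj
    unfold splitPhase
    split_ifs with h1 h2
    · have hj2 : j = 2 * m := by omega
      have e : 2 * π * j * k / (4 * m : ℕ) + π / 4 = (k : ℤ) * π + π / 4 := by
        have hj' : (j : ℝ) = 2 * m := by exact_mod_cast hj2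
        rw [hj']
        have hm : (m : ℝ) ≠ 0 := by norm_cast; omega
        push_cast
        field_simp
        ring
      rw [cos_sq_eq_of_eq_int_mul_pi_add e]
      have hm : (4 : ℝ) ≤ (4 * m : ℕ) := by norm_cast; omega
      have hpi := Real.pi_pos
      have hc : Real.cos (π / 4) ≤ Real.cos (π / (4 * m : ℕ)) :=
        Real.cos_le_cos_of_nonneg_of_le_pi (by positivity) (by linarith) (by gcongr)
      have hc0 : 0 ≤ Real.cos (π / 4) := by rw [Real.cos_pi_div_four]; positivity
      gcongr
    · convert hbound (2 * (j * k) + 1) (by simp) using 3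
      push_cast
      ring
    · convert hbound (2 * (j * k + m - 1) + 1) (by simp) using 3
      have hm : (m : ℝ) ≠ 0 := by norm_cast; omega
      push_cast
      field_simp
      ring
  · have h : splitPhase (4 * m) 1 = π / (4 * m : ℕ) := by
      rw [splitPhase, if_neg (by omega), if_pos (by omega)]
    simp [h]

theorem exists_coherence_eq_of_mod_four_eq_two {n : ℕ} (hn : 3 ≤ n) (h4 : n % 4 = 2) :
    ∃ Q : Matrix (Fin n) (Fin n) ℝ, Qᵀ * Q = 1 ∧
      (∀ k j : Fin n, (j : ℕ) = 0 → Q k j = 1 / Real.sqrt n) ∧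
      coherence n Q = 2 * Real.cos (π / (2 * n)) ^ 2 := by
  have hn' : (n : ℝ) ≠ 0 := by norm_cast; omega
  refine exists_orthogonal_coherence_eq (φ := fun _ => π / 4) (by omega)
    (fun _ _ _ _ _ => by ring) ?_ ?_
  · intro k j _
    obtain ⟨m, hm⟩ : ∃ m, n = 2 * (2 * m + 1) := ⟨n / 4, by omega⟩
    have h := cos_sq_odd_mul_pi_div_le (N := 2 * n) (a := 2 * (2 * (j * k) + m) + 1) (by omega)
      (by simp) (by simp)
    have e : 2 * π * j * k / n + π / 4 =
        ((2 * (2 * (j * k) + m) + 1 : ℤ) : ℝ) * π / (2 * n : ℤ) := by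
      have hm' : (n : ℝ) = 2 * (2 * m + 1) := by exact_mod_cast hm
      push_cast
      field_simp
      rw [hm']
      ring
    rw [e]
    exact_mod_cast h
  · obtain ⟨k, hk, h⟩ : ∃ k < n, 8 * k + n = 4 * n + 2 ∨ 8 * k + n + 2 = 4 * n := by
      rcases (by omega : n % 8 = 2 ∨ n % 8 = 6) with h | h
      · exact ⟨(3 * n + 2) / 8, by omega, by omega⟩
      · exact ⟨(3 * n - 2) / 8, by omega, by omega⟩
    refine ⟨k, 1, hk, by omega, one_ne_zero, ?_⟩
    rcases h with h | h <;> have h' := congrArg (Nat.cast (R := ℝ)) h <;> push_cast at h'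
    · refine cos_sq_eq_of_eq_int_mul_pi_add (m := 1) ?_
      push_cast
      field_simp
      linear_combination 2 * h'
    · rw [← Real.cos_neg (π / (2 * n))]
      refine cos_sq_eq_of_eq_int_mul_pi_add (m := 1) ?_
      push_cast
      field_simp
      linear_combination 2 * h'

theorem exists_coherence_eq_of_odd {n : ℕ} (hn : 3 ≤ n) (hodd : n % 2 = 1) :
    ∃ Q : Matrix (Fin n) (Fin n) ℝ, Qᵀ * Q = 1 ∧
      (∀ k j : Fin n, (j : ℕ) = 0 → Q k j = 1 / Real.sqrt n) ∧
      coherence n Q = 2 * Real.cos (π / (4 * n)) ^ 2 := by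
  have hn' : (n : ℝ) ≠ 0 := by norm_cast; omega
  refine exists_orthogonal_coherence_eq (φ := fun _ => π / 4) (by omega)
    (fun _ _ _ _ _ => by ring) ?_ ?_
  · intro k j _
    obtain ⟨m, hm⟩ : ∃ m, n = 2 * m + 1 := ⟨n / 2, by omega⟩
    have h := cos_sq_odd_mul_pi_div_le (N := 4 * n) (a := 2 * (4 * (j * k) + m) + 1) (by omega)
      (by rw [Int.even_iff]; omega) (by simp)
    have e : 2 * π * j * k / n + π / 4 =
        ((2 * (4 * (j * k) + m) + 1 : ℤ) : ℝ) * π / (4 * n : ℤ) := by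
      have hm' : (n : ℝ) = 2 * m + 1 := by exact_mod_cast hm
      push_cast
      field_simp
      rw [hm']
      ring
    rw [e]
    exact_mod_cast h
  · obtain ⟨k, m, hk, h⟩ : ∃ k m : ℕ, k < n ∧
        (8 * k + n = m * (4 * n) + 1 ∨ 8 * k + n + 1 = m * (4 * n)) := by
      rcases (by omega : n % 8 = 1 ∨ n % 8 = 3 ∨ n % 8 = 5 ∨ n % 8 = 7) with h | h | h | h
      · exact ⟨(7 * n + 1) / 8, 2, by omega, by omega⟩
      · exact ⟨(3 * n - 1) / 8, 1, by omega, by omega⟩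
      · exact ⟨(3 * n + 1) / 8, 1, by omega, by omega⟩
      · exact ⟨(7 * n - 1) / 8, 2, by omega, by omega⟩
    refine ⟨k, 1, hk, by omega, one_ne_zero, ?_⟩
    rcases h with h | h <;> have h' := congrArg (Nat.cast (R := ℝ)) h <;> push_cast at h'
    · refine cos_sq_eq_of_eq_int_mul_pi_add (m := m) ?_
      push_cast
      field_simp
      linear_combination h'
    · rw [← Real.cos_neg (π / (4 * n))]
      refine cos_sq_eq_of_eq_int_mul_pi_add (m := m) ?_
      push_cast
      field_simp
      linear_combination h'

theorem stmt12 (n : ℕ) (hn : 3 ≤ n) :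
    ∃ Q : Matrix (Fin n) (Fin n) ℝ, Qᵀ * Q = 1 ∧
      (∀ k j : Fin n, (j : ℕ) = 0 → Q k j = 1 / Real.sqrt n) ∧
      coherence n Q =
        (if n % 4 = 0 then 2 * Real.cos (Real.pi / n) ^ 2
         else if n % 4 = 2 then 2 * Real.cos (Real.pi / (2 * n)) ^ 2
         else 2 * Real.cos (Real.pi / (4 * n)) ^ 2) := by
  split_ifs with h0 h2
  · exact exists_coherence_eq_of_four_dvd hn h0
  · exact exists_coherence_eq_of_mod_four_eq_two hn h2
  · exact exists_coherence_eq_of_odd hn (by omega)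
end

section
/- For every integer n ≥ 3 that is not divisible by 8, δ_n^{(ph)} = δ_n, where δ_n := 1 − 1/(2·cos² Δ_n) with Δ_n := min over integers m, t of |2πm/n − (2t+1)π/4|, and δ_n^{(ph)} is defined piecewise as 1 − 1/(2·cos²(π/n)) if n ≡ 0 (mod 4), 1 − 1/(2·cos²(π/(2n))) if n ≡ 2 (mod 4), and 1 − 1/(2·cos²(π/(4n))) if n is odd. -/
open Real

/-- The phase-optimised threshold `δ_n^{(ph)}`. -/
noncomputable def deltaPh (n : ℕ) : ℝ :=
  if n % 4 = 0 then 1 - 1 / (2 * Real.cos (Real.pi / n) ^ 2)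
  else if n % 4 = 2 then 1 - 1 / (2 * Real.cos (Real.pi / (2 * n)) ^ 2)
  else 1 - 1 / (2 * Real.cos (Real.pi / (4 * n)) ^ 2)

/-- `Δ_n` is `π / (4n)` times the minimum `d` of `|8m − (2t+1)n|` over integers `m, t`. -/
lemma Delta_eq_of_isLeast {n : ℕ} (hn : 0 < n) {d : ℤ}
    (hd : IsLeast {k : ℤ | ∃ m t : ℤ, k = |8 * m - (2 * t + 1) * n|} d) :
    Delta n = Real.pi * d / (4 * n) := by
  have hn' : (0 : ℝ) < n := Nat.cast_pos.mpr hn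
  have key (m t : ℤ) :
      |2 * Real.pi * (m : ℝ) / (n : ℝ) - (2 * (t : ℝ) + 1) * Real.pi / 4|
        = Real.pi * (|8 * m - (2 * t + 1) * n| : ℤ) / (4 * n) := by
    have h : 2 * Real.pi * (m : ℝ) / (n : ℝ) - (2 * (t : ℝ) + 1) * Real.pi / 4
        = Real.pi / (4 * n) * (8 * m - (2 * t + 1) * n) := by
      field_simp
      ring
    rw [h, abs_mul, abs_of_pos (by positivity)]
    push_cast
    ring
  refine IsLeast.csInf_eq ⟨?_, ?_⟩
  · obtain ⟨m, t, h⟩ := hd.1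
    exact ⟨m, t, by rw [key, ← h]⟩
  · rintro x ⟨m, t, rfl⟩
    rw [key]
    have h : (d : ℝ) ≤ (|8 * m - (2 * t + 1) * n| : ℤ) := Int.cast_le.mpr (hd.2 ⟨m, t, rfl⟩)
    gcongr

/-- The minimum of `|8m − (2t+1)n|` over integers `m, t` depends only on `n` modulo `8`. -/
lemma isLeast_abs_of_mod_eight {n : ℕ} {q r d m₀ t₀ : ℤ} (hn : (n : ℤ) = 8 * q + r)
    (h₀ : |8 * m₀ - (2 * t₀ + 1) * r| = d)
    (h : ∀ s t : ℤ, d ≤ |8 * s - (2 * t + 1) * r|) :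
    IsLeast {k : ℤ | ∃ m t : ℤ, k = |8 * m - (2 * t + 1) * n|} d := by
  constructor
  · refine ⟨m₀ + (2 * t₀ + 1) * q, t₀, ?_⟩
    rw [← h₀, hn]
    ring_nf
  · rintro k ⟨m, t, rfl⟩
    convert h (m - (2 * t + 1) * q) t using 2
    rw [hn]
    ring

theorem stmt14 (n : ℕ) (hn : 3 ≤ n) (h8 : ¬ (8 ∣ n)) :
    deltaPh n = deltaCycle n := by
  have hpos : 0 < n := by omega
  have hn' : (0 : ℝ) < n := Nat.cast_pos.mpr hpos
  have hmod : (n : ℤ) = 8 * (n / 8 : ℕ) + (n % 8 : ℕ) := by omega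
  unfold deltaPh deltaCycle
  split_ifs with h4 h2
  · have hr : n % 8 = 4 := by omega
    rw [hr] at hmod
    rw [Delta_eq_of_isLeast hpos (isLeast_abs_of_mod_eight (d := 4) (m₀ := 0) (t₀ := 0) hmod
      (by norm_num) (by intros; rw [le_abs]; push_cast; omega))]
    congr 5
    push_cast
    field_simp
  · have hd : IsLeast {k : ℤ | ∃ m t : ℤ, k = |8 * m - (2 * t + 1) * n|} 2 := by
      obtain hr | hr : n % 8 = 2 ∨ n % 8 = 6 := by omega
      · rw [hr] at hmod
        exact isLeast_abs_of_mod_eight (m₀ := 0) (t₀ := 0) hmod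
          (by norm_num) (by intros; rw [le_abs]; push_cast; omega)
      · rw [hr] at hmod
        exact isLeast_abs_of_mod_eight (m₀ := 1) (t₀ := 0) hmod
          (by norm_num) (by intros; rw [le_abs]; push_cast; omega)
    rw [Delta_eq_of_isLeast hpos hd]
    congr 5
    push_cast
    field_simp
    norm_num
  · have hd : IsLeast {k : ℤ | ∃ m t : ℤ, k = |8 * m - (2 * t + 1) * n|} 1 := by
      obtain hr | hr | hr | hr : n % 8 = 1 ∨ n % 8 = 3 ∨ n % 8 = 5 ∨ n % 8 = 7 := by omega
      · rw [hr] at hmod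
        exact isLeast_abs_of_mod_eight (m₀ := 0) (t₀ := 0) hmod
          (by norm_num) (by intros; rw [le_abs]; push_cast; omega)
      · rw [hr] at hmod
        exact isLeast_abs_of_mod_eight (m₀ := 1) (t₀ := 1) hmod
          (by norm_num) (by intros; rw [le_abs]; push_cast; omega)
      · rw [hr] at hmod
        exact isLeast_abs_of_mod_eight (m₀ := 3) (t₀ := 2) hmod
          (by norm_num) (by intros; rw [le_abs]; push_cast; omega)
      · rw [hr] at hmod
        exact isLeast_abs_of_mod_eight (m₀ := 1) (t₀ := 0) hmod
          (by norm_num) (by intros; rw [le_abs]; push_cast; omega)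
    rw [Delta_eq_of_isLeast hpos hd]
    simp
end

section
/- For every integer n ≥ 3 there exists a real orthogonal n×n matrix Q with first column (1/√n)·𝟏 such that for every real list (λ_0, λ_1, …, λ_{n−1}) with λ_0 = 1, λ_j ∈ [−1, 0] for 1 ≤ j ≤ n−1, and 1 + ∑_{j=1}^{n−1} λ_j > 1/2, the matrix Q Λ Qᵀ with Λ = diag(λ_0,…,λ_{n−1}) is symmetric and doubly stochastic. -/
open Real Matrix Finset

/-- Telescoping of a sum of cosines at odd multiples of an angle. -/
lemma two_sin_mul_sum_cos_odd (n : ℕ) (x : ℝ) :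
    2 * Real.sin x * ∑ k ∈ Finset.range n, Real.cos ((2 * k + 1) * x) =
      Real.sin (2 * n * x) := by
  induction n with
  | zero => simp
  | succ n ih =>
    have h₁ : 2 * ((n + 1 : ℕ) : ℝ) * x = (2 * n + 1) * x + x := by push_cast; ring
    have h₂ : 2 * (n : ℝ) * x = (2 * n + 1) * x - x := by ring
    rw [Finset.sum_range_succ, mul_add, ih, h₁, h₂, Real.sin_add, Real.sin_sub]
    ring

lemma sum_cos_odd_eq_zero {n : ℕ} {m : ℤ} (hm : m ≠ 0) (hlt : |m| < 2 * n) :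
    ∑ k : Fin n, Real.cos ((2 * (k : ℕ) + 1) * (m * π / (2 * n))) = 0 := by
  have hn : (0 : ℝ) < n := by
    have : 0 < n := by have := abs_nonneg m; omega
    exact_mod_cast this
  rw [Fin.sum_univ_eq_sum_range (fun k : ℕ => Real.cos ((2 * k + 1) * (m * π / (2 * n)))) n]
  have h := two_sin_mul_sum_cos_odd n (m * π / (2 * n))
  have hx : 2 * (n : ℝ) * (m * π / (2 * n)) = m * π := by field_simp
  rw [hx, Real.sin_int_mul_pi] at h
  have hs : Real.sin (m * π / (2 * n)) ≠ 0 := by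
    intro h0
    rw [Real.sin_eq_zero_iff] at h0
    obtain ⟨t, ht⟩ := h0
    have hmt : (m : ℝ) = 2 * n * t := by
      field_simp at ht
      linarith
    have hmt' : m = 2 * n * t := by exact_mod_cast hmt
    exact hm (Int.eq_zero_of_abs_lt_dvd ⟨t, hmt'⟩ hlt)
  exact (mul_eq_zero.mp h).resolve_left (mul_ne_zero two_ne_zero hs)

/-- The orthogonal type II discrete cosine transform, basis vectors as columns. -/
noncomputable def dctMatrix (n : ℕ) : Matrix (Fin n) (Fin n) ℝ := fun k j =>
  if (j : ℕ) = 0 then 1 / Real.sqrt n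
  else Real.sqrt (2 / n) * Real.cos ((2 * (k : ℕ) + 1) * ((j : ℕ) * π / (2 * n)))

lemma dctMatrix_sum_col {n : ℕ} (j : Fin n) (hj : (j : ℕ) ≠ 0) :
    ∑ k, dctMatrix n k j = 0 := by
  have h := sum_cos_odd_eq_zero (n := n) (m := (j : ℕ)) (by omega)
    (by rw [abs_lt]; omega)
  simp only [dctMatrix, if_neg hj, ← Finset.mul_sum]
  push_cast at h
  rw [h, mul_zero]

lemma dctMatrix_sum_mul_self {n : ℕ} (j : Fin n) :
    ∑ k, dctMatrix n k j * dctMatrix n k j = 1 := by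
  have hn : (0 : ℝ) < n := by exact_mod_cast j.pos
  by_cases hj : (j : ℕ) = 0
  · simp only [dctMatrix, if_pos hj, Finset.sum_const, Finset.card_univ, Fintype.card_fin,
      nsmul_eq_mul]
    rw [div_mul_div_comm, Real.mul_self_sqrt hn.le]
    field_simp
  · have h := sum_cos_odd_eq_zero (n := n) (m := 2 * (j : ℕ)) (by omega)
      (by rw [abs_lt]; omega)
    have hk : ∀ k : Fin n, dctMatrix n k j * dctMatrix n k j =
        1 / n + 1 / n * Real.cos ((2 * (k : ℕ) + 1) *
          (((2 * (j : ℕ) : ℤ) : ℝ) * π / (2 * n))) := by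
      intro k
      have hx : (2 * (k : ℕ) + 1) * (((2 * (j : ℕ) : ℤ) : ℝ) * π / (2 * n)) =
          2 * ((2 * (k : ℕ) + 1) * ((j : ℕ) * π / (2 * n))) := by push_cast; ring
      rw [hx, Real.cos_two_mul]
      simp only [dctMatrix, if_neg hj]
      rw [mul_mul_mul_comm, Real.mul_self_sqrt (by positivity)]
      ring
    rw [Finset.sum_congr rfl fun k _ => hk k, Finset.sum_add_distrib, ← Finset.mul_sum, h]
    simp [hn.ne']

lemma dctMatrix_sum_mul_of_ne {n : ℕ} {i j : Fin n} (hij : i ≠ j) :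
    ∑ k, dctMatrix n k i * dctMatrix n k j = 0 := by
  have hij' : (i : ℕ) ≠ j := fun h => hij (Fin.ext h)
  by_cases hi : (i : ℕ) = 0
  · have hi' : ∀ k, dctMatrix n k i = 1 / Real.sqrt n := fun k => if_pos hi
    simp only [hi', ← Finset.mul_sum, dctMatrix_sum_col j (by omega), mul_zero]
  by_cases hj : (j : ℕ) = 0
  · have hj' : ∀ k, dctMatrix n k j = 1 / Real.sqrt n := fun k => if_pos hj
    simp only [hj', ← Finset.sum_mul, dctMatrix_sum_col i hi, zero_mul]
  have h₁ := sum_cos_odd_eq_zero (n := n) (m := (i : ℕ) + (j : ℕ)) (by omega)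
    (by rw [abs_lt]; omega)
  have h₂ := sum_cos_odd_eq_zero (n := n) (m := (i : ℕ) - (j : ℕ)) (by omega)
    (by rw [abs_lt]; omega)
  have hk : ∀ k : Fin n, dctMatrix n k i * dctMatrix n k j =
      Real.sqrt (2 / n) * Real.sqrt (2 / n) / 2 *
        (Real.cos ((2 * (k : ℕ) + 1) * ((((i : ℕ) + (j : ℕ) : ℤ) : ℝ) * π / (2 * n))) +
        Real.cos ((2 * (k : ℕ) + 1) * ((((i : ℕ) - (j : ℕ) : ℤ) : ℝ) * π / (2 * n)))) := by
    intro k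
    have ha : (2 * (k : ℕ) + 1) * ((((i : ℕ) + (j : ℕ) : ℤ) : ℝ) * π / (2 * n)) =
        (2 * (k : ℕ) + 1) * ((i : ℕ) * π / (2 * n)) +
          (2 * (k : ℕ) + 1) * ((j : ℕ) * π / (2 * n)) := by push_cast; ring
    have hb : (2 * (k : ℕ) + 1) * ((((i : ℕ) - (j : ℕ) : ℤ) : ℝ) * π / (2 * n)) =
        (2 * (k : ℕ) + 1) * ((i : ℕ) * π / (2 * n)) -
          (2 * (k : ℕ) + 1) * ((j : ℕ) * π / (2 * n)) := by push_cast; ring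
    rw [ha, hb, Real.cos_add, Real.cos_sub]
    simp only [dctMatrix, if_neg hi, if_neg hj]
    ring
  rw [Finset.sum_congr rfl fun k _ => hk k, ← Finset.mul_sum, Finset.sum_add_distrib, h₁, h₂]
  simp

lemma dctMatrix_transpose_mul_self (n : ℕ) : (dctMatrix n)ᵀ * dctMatrix n = 1 := by
  ext i j
  simp only [Matrix.mul_apply, Matrix.transpose_apply]
  rcases eq_or_ne i j with rfl | hij
  · rw [dctMatrix_sum_mul_self, Matrix.one_apply_eq]
  · rw [dctMatrix_sum_mul_of_ne hij, Matrix.one_apply_ne hij]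

lemma dctMatrix_mul_le {n : ℕ} (k l j : Fin n) :
    dctMatrix n k j * dctMatrix n l j ≤ 2 / n := by
  have hn : (0 : ℝ) < n := by exact_mod_cast j.pos
  by_cases hj : (j : ℕ) = 0
  · simp only [dctMatrix, if_pos hj]
    rw [div_mul_div_comm, Real.mul_self_sqrt hn.le]
    gcongr
    norm_num
  · simp only [dctMatrix, if_neg hj]
    rw [mul_mul_mul_comm, Real.mul_self_sqrt (by positivity)]
    refine mul_le_of_le_one_right (by positivity) ((le_abs_self _).trans ?_)
    rw [abs_mul]
    exact mul_le_one₀ (Real.abs_cos_le_one _) (abs_nonneg _) (Real.abs_cos_le_one _)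

lemma mul_diagonal_mul_transpose_apply {n : ℕ} (Q : Matrix (Fin n) (Fin n) ℝ) (d : Fin n → ℝ)
    (k l : Fin n) :
    (Q * Matrix.diagonal d * Qᵀ) k l = ∑ j, d j * (Q k j * Q l j) := by
  rw [Matrix.mul_apply]
  refine Finset.sum_congr rfl fun j _ => ?_
  rw [Matrix.mul_diagonal, Matrix.transpose_apply]
  ring

theorem stmt15 (n : ℕ) (hn : 3 ≤ n) :
    ∃ Q : Matrix (Fin n) (Fin n) ℝ, Qᵀ * Q = 1 ∧
      (∀ k j : Fin n, (j : ℕ) = 0 → Q k j = 1 / Real.sqrt n) ∧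
      ∀ lam : Fin n → ℝ,
        (∀ j : Fin n, (j : ℕ) = 0 → lam j = 1) →
        (∀ j : Fin n, (j : ℕ) ≠ 0 → lam j ∈ Set.Icc (-1 : ℝ) 0) →
        1 + ∑ j ∈ Finset.univ.filter (fun j : Fin n => (j : ℕ) ≠ 0), lam j > 1 / 2 →
        (Q * Matrix.diagonal lam * Qᵀ)ᵀ = Q * Matrix.diagonal lam * Qᵀ ∧
          (∀ k l : Fin n, 0 ≤ (Q * Matrix.diagonal lam * Qᵀ) k l) ∧
          (∀ k : Fin n, ∑ l : Fin n, (Q * Matrix.diagonal lam * Qᵀ) k l = 1) ∧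
          (∀ l : Fin n, ∑ k : Fin n, (Q * Matrix.diagonal lam * Qᵀ) k l = 1) := by
  have hn0 : (0 : ℝ) < n := by exact_mod_cast (by omega : 0 < n)
  have hQ0 : ∀ k j : Fin n, (j : ℕ) = 0 → dctMatrix n k j = 1 / Real.sqrt n :=
    fun k j hj => if_pos hj
  refine ⟨dctMatrix n, dctMatrix_transpose_mul_self n, hQ0, fun lam h0 hI hsum => ?_⟩
  have hsymm : (dctMatrix n * Matrix.diagonal lam * (dctMatrix n)ᵀ)ᵀ =
      dctMatrix n * Matrix.diagonal lam * (dctMatrix n)ᵀ := by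
    simp [Matrix.transpose_mul, Matrix.mul_assoc]
  have hfilter : Finset.univ.filter (fun j : Fin n => (j : ℕ) = 0) = {⟨0, by omega⟩} := by
    ext j
    simp [Fin.ext_iff]
  have hrow : ∀ k : Fin n,
      ∑ l : Fin n, (dctMatrix n * Matrix.diagonal lam * (dctMatrix n)ᵀ) k l = 1 := by
    intro k
    simp only [mul_diagonal_mul_transpose_apply]
    rw [Finset.sum_comm]
    simp only [← Finset.mul_sum]
    rw [Finset.sum_eq_single (⟨0, by omega⟩ : Fin n)]
    · rw [h0 _ rfl]
      simp only [hQ0 _ ⟨0, by omega⟩ rfl, Finset.sum_const, Finset.card_univ, Fintype.card_fin,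
        nsmul_eq_mul]
      have hs := Real.mul_self_sqrt hn0.le
      have hs0 : Real.sqrt n ≠ 0 := (Real.sqrt_pos.mpr hn0).ne'
      field_simp
      linarith
    · intro j _ hj
      rw [dctMatrix_sum_col j fun h => hj (Fin.ext h), mul_zero, mul_zero]
    · simp
  refine ⟨hsymm, fun k l => ?_, hrow, fun l => ?_⟩
  · rw [mul_diagonal_mul_transpose_apply,
      ← Finset.sum_filter_add_sum_filter_not _ (fun j : Fin n => (j : ℕ) = 0), hfilter,
      Finset.sum_singleton, h0 _ rfl, hQ0 _ _ rfl, hQ0 _ _ rfl, div_mul_div_comm,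
      Real.mul_self_sqrt hn0.le]
    have hle : ∑ j ∈ Finset.univ.filter (fun j : Fin n => (j : ℕ) ≠ 0), lam j * (2 / n) ≤
        ∑ j ∈ Finset.univ.filter (fun j : Fin n => (j : ℕ) ≠ 0),
          lam j * (dctMatrix n k j * dctMatrix n l j) :=
      Finset.sum_le_sum fun j hj => mul_le_mul_of_nonpos_left (dctMatrix_mul_le k l j)
        (hI j (Finset.mem_filter.mp hj).2).2
    rw [← Finset.sum_mul] at hle
    have hhalf : -(1 / 2) * (2 / (n : ℝ)) ≤
        (∑ j ∈ Finset.univ.filter (fun j : Fin n => (j : ℕ) ≠ 0), lam j) * (2 / n) :=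
      mul_le_mul_of_nonneg_right (by linarith) (by positivity)
    have hone : 1 * (1 * 1 / (n : ℝ)) + -(1 / 2) * (2 / (n : ℝ)) = 0 := by ring
    linarith
  · rw [← hrow l]
    exact Finset.sum_congr rfl fun k _ => congrFun (congrFun hsymm l) k
end

section
/- Let d ≥ 1 and n = 2^d, and let H be the n×n matrix indexed by pairs of elements a, x of (ℤ/2ℤ)^d with entries H(a, x) = (−1)^{a·x}, where a·x = ∑_{i=1}^d a_i x_i computed in ℤ/2ℤ (lifted to the exponent as 0 or 1). Then H has all entries ±1, satisfies H·Hᵀ = n·I, and its column indexed by 0 is the all-ones vector; hence Q := H/√n is orthogonal with first column (1/√n)·𝟏 and M(Q) = 1, and for every real list (λ_0, λ_1, …, λ_{n−1}) with λ_0 = 1, λ_j ≤ 0 for 1 ≤ j ≤ n−1, and 1 + ∑_{j=1}^{n−1} λ_j > 0, the matrix Q Λ Qᵀ is symmetric and doubly stochastic. -/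
open Real Matrix Finset

/-- The Walsh–Hadamard (Sylvester) matrix of order `2^d`, indexed by the
elementary abelian 2-group `(ℤ/2ℤ)^d`: entry `(a, x)` is `(−1)^{a·x}`. -/
noncomputable def walshHadamard (d : ℕ) :
    Matrix (Fin d → ZMod 2) (Fin d → ZMod 2) ℝ :=
  Matrix.of fun a x => (-1 : ℝ) ^ ((∑ i : Fin d, a i * x i : ZMod 2)).val

/-- Coherence of a square real matrix indexed by a finite type with a
distinguished zero index: `M(Q) = n · max_{j ≠ 0} ‖q_j‖_∞²`. -/
noncomputable def coherence' {G : Type*} [Fintype G] [Zero G]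
    (Q : Matrix G G ℝ) : ℝ :=
  (Fintype.card G : ℝ) *
    sSup {x : ℝ | ∃ j : G, j ≠ 0 ∧ x = ‖(fun k : G => Q k j)‖ ^ 2}

theorem neg_one_pow_val_add (u v : ZMod 2) :
    (-1 : ℝ) ^ (u + v).val = (-1) ^ u.val * (-1) ^ v.val := by
  rw [ZMod.val_add, ← pow_add, neg_one_pow_eq_pow_mod_two (n := u.val + v.val)]

theorem walshHadamard_eq_one_or {d : ℕ} (a x : Fin d → ZMod 2) :
    walshHadamard d a x = 1 ∨ walshHadamard d a x = -1 :=
  neg_one_pow_eq_or ℝ _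

theorem walshHadamard_comm {d : ℕ} (a x : Fin d → ZMod 2) :
    walshHadamard d a x = walshHadamard d x a := by
  simp [walshHadamard, mul_comm]

theorem walshHadamard_transpose (d : ℕ) : (walshHadamard d)ᵀ = walshHadamard d := by
  ext a x
  exact walshHadamard_comm x a

theorem walshHadamard_add_right {d : ℕ} (a x y : Fin d → ZMod 2) :
    walshHadamard d a (x + y) = walshHadamard d a x * walshHadamard d a y := by
  simp [walshHadamard, mul_add, Finset.sum_add_distrib, neg_one_pow_val_add]

theorem walshHadamard_zero_right {d : ℕ} (a : Fin d → ZMod 2) :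
    walshHadamard d a 0 = 1 := by
  simp [walshHadamard]

theorem walshHadamard_abs {d : ℕ} (a x : Fin d → ZMod 2) : |walshHadamard d a x| = 1 := by
  rcases walshHadamard_eq_one_or a x with h | h <;> simp [h]

theorem sum_walshHadamard {d : ℕ} (a : Fin d → ZMod 2) :
    ∑ x, walshHadamard d a x = if a = 0 then (2 : ℝ) ^ d else 0 := by
  split_ifs with ha
  · subst ha
    simp [walshHadamard_comm 0, walshHadamard_zero_right]
  · obtain ⟨i, hi⟩ := Function.ne_iff.mp ha
    have hi1 : a i = 1 := by
      have : ∀ u : ZMod 2, u ≠ 0 → u = 1 := by decide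
      exact this _ hi
    have hneg : walshHadamard d a (Pi.single i 1) = -1 := by
      simp [walshHadamard, Pi.single_apply, hi1, ZMod.val_one]
    have hshift := Equiv.sum_comp (Equiv.addRight (Pi.single i 1)) (walshHadamard d a)
    simp only [Equiv.coe_addRight, walshHadamard_add_right, hneg, mul_neg, mul_one,
      Finset.sum_neg_distrib] at hshift
    linarith

theorem walshHadamard_mul_transpose (d : ℕ) :
    walshHadamard d * (walshHadamard d)ᵀ =
      ((2 ^ d : ℕ) : ℝ) • (1 : Matrix (Fin d → ZMod 2) (Fin d → ZMod 2) ℝ) := by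
  ext a b
  have hadd (x) : walshHadamard d a x * walshHadamard d b x = walshHadamard d (a + b) x := by
    rw [walshHadamard_comm a, walshHadamard_comm b, walshHadamard_comm (a + b),
      walshHadamard_add_right]
  have hab : a + b = 0 ↔ a = b := by
    simp only [funext_iff, Pi.add_apply, Pi.zero_apply, CharTwo.add_eq_zero]
  simp [Matrix.mul_apply, hadd, sum_walshHadamard, hab, Matrix.one_apply]

theorem inv_sqrt_sq_mul (d : ℕ) :
    (Real.sqrt (2 ^ d))⁻¹ * (Real.sqrt (2 ^ d))⁻¹ * 2 ^ d = 1 := by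
  rw [← mul_inv, Real.mul_self_sqrt (by positivity)]
  exact inv_mul_cancel₀ (by positivity)

theorem coherence'_walshHadamard {d : ℕ} (hd : 1 ≤ d) :
    coherence' ((Real.sqrt (2 ^ d))⁻¹ • walshHadamard d) = 1 := by
  have hnorm (j : Fin d → ZMod 2) :
      ‖fun k => ((Real.sqrt (2 ^ d))⁻¹ • walshHadamard d) k j‖ = (Real.sqrt (2 ^ d))⁻¹ := by
    have hentry (k) :
        ‖((Real.sqrt (2 ^ d))⁻¹ • walshHadamard d) k j‖ = (Real.sqrt (2 ^ d))⁻¹ := by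
      rw [Matrix.smul_apply, smul_eq_mul, Real.norm_eq_abs, abs_mul, walshHadamard_abs, mul_one,
        abs_of_nonneg (by positivity)]
    refine le_antisymm ((pi_norm_le_iff_of_nonneg (by positivity)).2 fun k => (hentry k).le) ?_
    exact (hentry 0).ge.trans
      (norm_le_pi_norm (fun k => ((Real.sqrt (2 ^ d))⁻¹ • walshHadamard d) k j) 0)
  have hset : {x : ℝ | ∃ j : Fin d → ZMod 2, j ≠ 0 ∧
      x = ‖fun k => ((Real.sqrt (2 ^ d))⁻¹ • walshHadamard d) k j‖ ^ 2} =
      {(Real.sqrt (2 ^ d))⁻¹ ^ 2} := by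
    have : Nonempty (Fin d) := ⟨⟨0, hd⟩⟩
    obtain ⟨j, hj⟩ := exists_ne (0 : Fin d → ZMod 2)
    ext x
    simp only [hnorm, Set.mem_ofPred_eq, Set.mem_singleton_iff]
    exact ⟨fun ⟨_, _, h⟩ => h, fun h => ⟨j, hj, h⟩⟩
  rw [coherence', hset, csSup_singleton, sq, mul_comm]
  simpa using inv_sqrt_sq_mul d

theorem walshHadamard_conj_apply {d : ℕ} (lam : (Fin d → ZMod 2) → ℝ) (k l : Fin d → ZMod 2) :
    (((Real.sqrt (2 ^ d))⁻¹ • walshHadamard d) * Matrix.diagonal lam *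
      ((Real.sqrt (2 ^ d))⁻¹ • walshHadamard d)ᵀ) k l =
    (Real.sqrt (2 ^ d))⁻¹ * (Real.sqrt (2 ^ d))⁻¹ *
      ∑ j, walshHadamard d k j * walshHadamard d l j * lam j := by
  rw [Matrix.mul_apply]
  simp only [Matrix.mul_diagonal, Matrix.transpose_apply, Matrix.smul_apply, smul_eq_mul,
    Finset.mul_sum]
  exact Finset.sum_congr rfl fun j _ => by ring

theorem walshHadamard_conj_transpose {d : ℕ} (lam : (Fin d → ZMod 2) → ℝ) :
    (((Real.sqrt (2 ^ d))⁻¹ • walshHadamard d) * Matrix.diagonal lam *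
      ((Real.sqrt (2 ^ d))⁻¹ • walshHadamard d)ᵀ)ᵀ =
    ((Real.sqrt (2 ^ d))⁻¹ • walshHadamard d) * Matrix.diagonal lam *
      ((Real.sqrt (2 ^ d))⁻¹ • walshHadamard d)ᵀ := by
  simp only [Matrix.transpose_mul, Matrix.transpose_transpose, Matrix.diagonal_transpose,
    Matrix.mul_assoc]

theorem walshHadamard_conj_nonneg {d : ℕ} {lam : (Fin d → ZMod 2) → ℝ} (h0 : lam 0 = 1)
    (hneg : ∀ j, j ≠ 0 → lam j ≤ 0)
    (hsum : 0 ≤ 1 + ∑ j ∈ Finset.univ.filter (fun j : Fin d → ZMod 2 => j ≠ 0), lam j)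
    (k l : Fin d → ZMod 2) :
    0 ≤ (((Real.sqrt (2 ^ d))⁻¹ • walshHadamard d) * Matrix.diagonal lam *
      ((Real.sqrt (2 ^ d))⁻¹ • walshHadamard d)ᵀ) k l := by
  rw [walshHadamard_conj_apply]
  refine mul_nonneg (by positivity) (hsum.trans ?_)
  rw [Finset.filter_ne', ← h0, Finset.add_sum_erase _ _ (Finset.mem_univ _)]
  refine Finset.sum_le_sum fun j _ => ?_
  by_cases hj : j = 0
  · simp [hj, walshHadamard_zero_right]
  · have hle : walshHadamard d k j * walshHadamard d l j ≤ 1 := by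
      refine (le_abs_self _).trans ?_
      rw [abs_mul, walshHadamard_abs, walshHadamard_abs, mul_one]
    nlinarith [hneg j hj]

theorem walshHadamard_conj_row_sum {d : ℕ} {lam : (Fin d → ZMod 2) → ℝ} (h0 : lam 0 = 1)
    (k : Fin d → ZMod 2) :
    ∑ l, (((Real.sqrt (2 ^ d))⁻¹ • walshHadamard d) * Matrix.diagonal lam *
      ((Real.sqrt (2 ^ d))⁻¹ • walshHadamard d)ᵀ) k l = 1 := by
  simp only [walshHadamard_conj_apply]
  rw [← Finset.mul_sum, Finset.sum_comm]
  have hcol (j) : ∑ l, walshHadamard d k j * walshHadamard d l j * lam j =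
      if j = 0 then 2 ^ d else 0 := by
    rw [← Finset.sum_mul, ← Finset.mul_sum]
    simp only [fun l => walshHadamard_comm l j, sum_walshHadamard]
    split_ifs with hj
    · simp [hj, h0, walshHadamard_comm 0, walshHadamard_zero_right]
    · simp
  simp only [hcol, Finset.sum_ite_eq', Finset.mem_univ, if_true]
  exact inv_sqrt_sq_mul d

theorem stmt19 (d : ℕ) (hd : 1 ≤ d) :
    (∀ a x : Fin d → ZMod 2, walshHadamard d a x = 1 ∨ walshHadamard d a x = -1) ∧
      walshHadamard d * (walshHadamard d)ᵀ
        = ((2 ^ d : ℕ) : ℝ) • (1 : Matrix (Fin d → ZMod 2) (Fin d → ZMod 2) ℝ) ∧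
      (∀ a : Fin d → ZMod 2, walshHadamard d a 0 = 1) ∧
      (((Real.sqrt (2 ^ d))⁻¹ • walshHadamard d)ᵀ *
          ((Real.sqrt (2 ^ d))⁻¹ • walshHadamard d) = 1) ∧
      (∀ a : Fin d → ZMod 2,
        ((Real.sqrt (2 ^ d))⁻¹ • walshHadamard d) a 0 = 1 / Real.sqrt (2 ^ d)) ∧
      coherence' ((Real.sqrt (2 ^ d))⁻¹ • walshHadamard d) = 1 ∧
      ∀ lam : (Fin d → ZMod 2) → ℝ,
        lam 0 = 1 →
        (∀ j : Fin d → ZMod 2, j ≠ 0 → lam j ≤ 0) →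
        1 + ∑ j ∈ Finset.univ.filter (fun j : Fin d → ZMod 2 => j ≠ 0), lam j > 0 →
        (((Real.sqrt (2 ^ d))⁻¹ • walshHadamard d) * Matrix.diagonal lam *
              ((Real.sqrt (2 ^ d))⁻¹ • walshHadamard d)ᵀ)ᵀ
            = ((Real.sqrt (2 ^ d))⁻¹ • walshHadamard d) * Matrix.diagonal lam *
              ((Real.sqrt (2 ^ d))⁻¹ • walshHadamard d)ᵀ ∧
          (∀ k l : Fin d → ZMod 2,
            0 ≤ (((Real.sqrt (2 ^ d))⁻¹ • walshHadamard d) * Matrix.diagonal lam *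
              ((Real.sqrt (2 ^ d))⁻¹ • walshHadamard d)ᵀ) k l) ∧
          (∀ k : Fin d → ZMod 2, ∑ l : Fin d → ZMod 2,
            (((Real.sqrt (2 ^ d))⁻¹ • walshHadamard d) * Matrix.diagonal lam *
              ((Real.sqrt (2 ^ d))⁻¹ • walshHadamard d)ᵀ) k l = 1) ∧
          (∀ l : Fin d → ZMod 2, ∑ k : Fin d → ZMod 2,
            (((Real.sqrt (2 ^ d))⁻¹ • walshHadamard d) * Matrix.diagonal lam *
              ((Real.sqrt (2 ^ d))⁻¹ • walshHadamard d)ᵀ) k l = 1) := by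
  refine ⟨walshHadamard_eq_one_or, walshHadamard_mul_transpose d, walshHadamard_zero_right, ?_,
    fun a => ?_, coherence'_walshHadamard hd, fun lam h0 hneg hsum =>
    ⟨walshHadamard_conj_transpose lam, walshHadamard_conj_nonneg h0 hneg hsum.le,
      walshHadamard_conj_row_sum h0, fun l => ?_⟩⟩
  · have hmul := walshHadamard_mul_transpose d
    rw [walshHadamard_transpose] at hmul
    rw [Matrix.transpose_smul, walshHadamard_transpose, Matrix.smul_mul, Matrix.mul_smul, hmul,
      smul_smul, smul_smul, Nat.cast_pow, Nat.cast_ofNat, inv_sqrt_sq_mul, one_smul]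
  · rw [Matrix.smul_apply, walshHadamard_zero_right, smul_eq_mul, mul_one, one_div]
  · rw [← walshHadamard_conj_row_sum h0 l]
    refine Finset.sum_congr rfl fun k _ => ?_
    exact congrFun (congrFun (walshHadamard_conj_transpose lam) l) k
end
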